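/- Let p̄_c ∈ Ω^u_M be a cookie environment with α(M,p̄_c) = 1. Then there exists a constant C > 0 (depending on (M,p̄_c)) such that v(M,p̄)/(α(M,p̄) − 1) → C as p̄ → p̄_c with p̄ ∈ Ω^u_M and α(M,p̄) > 1. -/

import Mathlib

open MeasureTheory ProbabilityTheory Filter Finset Topology Asymptotics
open scoped ENNReal NNReal

noncomputable section

/-- Strength of the `i`-th cookie (1-indexed): `p i` for `1 ≤ i ≤ M`, `1/2` otherwise. -/
def strength (M : ℕ) (p : Fin M → ℝ) (i : ℕ) : ℝ :=
  if h : 1 ≤ i ∧ i ≤ M then p ⟨i - 1, by omega⟩ else 1 / 2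

/-- `α(M,p̄) = Σ_{i=1}^M (2 p_i − 1) − 1`. -/
def cookieAlpha (M : ℕ) (p : Fin M → ℝ) : ℝ := (∑ i, (2 * p i - 1)) - 1

/-- The set `Ω^u_M` of uniform cookie environments: `1/2 ≤ p_i < 1` for all `i`. -/
def OmegaU (M : ℕ) : Set (Fin M → ℝ) := {p | ∀ i, 1 / 2 ≤ p i ∧ p i < 1}

/-- `X` is an `(M,p̄)`-cookie random walk under the probability measure `P`: it starts at `0`,
is a nearest-neighbour path, and conditionally on the past it jumps to the right with
probability given by the strength of the cookie corresponding to the number of previous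
visits to the current site. -/
structure IsCookieRW {Ω : Type*} [MeasurableSpace Ω] (M : ℕ) (p : Fin M → ℝ)
    (P : Measure Ω) (X : ℕ → Ω → ℤ) : Prop where
  isProb : IsProbabilityMeasure P
  meas : ∀ n, Measurable (X n)
  init : P {ω | X 0 ω = 0} = 1
  nearest : P {ω | ∀ n, |X (n + 1) ω - X n ω| = 1} = 1
  step : ∀ (n : ℕ) (x : ℕ → ℤ),
    P {ω | (∀ k ≤ n, X k ω = x k) ∧ X (n + 1) ω = x n + 1}
      = ENNReal.ofReal
          (strength M p (((Finset.range (n + 1)).filter fun i => x i = x n).card))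
        * P {ω | ∀ k ≤ n, X k ω = x k}

namespace CookieWalk

/-- Prepend a term to a sequence. -/
def scons {α : Type*} (a : α) (τ : ℕ → α) : ℕ → α
  | 0 => a
  | n + 1 => τ n

@[simp] lemma scons_zero {α : Type*} (a : α) (τ : ℕ → α) : scons a τ 0 = a := rfl

@[simp] lemma scons_succ {α : Type*} (a : α) (τ : ℕ → α) (n : ℕ) : scons a τ (n + 1) = τ n := rfl

lemma measurable_scons {α : Type*} [MeasurableSpace α] :
    Measurable fun z : α × (ℕ → α) => scons z.1 z.2 := by
  refine measurable_pi_lambda _ fun n => ?_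
  cases n with
  | zero => exact measurable_fst
  | succ n => exact (measurable_pi_apply n).comp measurable_snd

/-- A product measure over `ℕ` splits off its first factor. -/
lemma map_scons {α : Type*} [MeasurableSpace α] (μ : ℕ → Measure α)
    [∀ i, IsProbabilityMeasure (μ i)] :
    ((μ 0).prod (Measure.infinitePi fun i => μ (i + 1))).map (fun z => scons z.1 z.2)
      = Measure.infinitePi μ := by
  refine Measure.eq_infinitePi _ fun s t ht => ?_
  rw [Measure.map_apply measurable_scons (.pi s.countable_toSet fun _ _ => ht _)]
  have hpre : (fun z : α × (ℕ → α) => scons z.1 z.2) ⁻¹' (Set.pi (s : Set ℕ) t)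
      = (if 0 ∈ s then t 0 else Set.univ) ×ˢ
        Set.pi (s.preimage Nat.succ Nat.succ_injective.injOn : Set ℕ) fun i => t (i + 1) := by
    ext z
    simp only [Set.mem_preimage, Set.mem_pi, Set.mem_prod, Finset.mem_coe, Finset.mem_preimage]
    constructor
    · intro h
      refine ⟨?_, fun i hi => h (i + 1) hi⟩
      split_ifs with h0
      · exact h 0 h0
      · trivial
    · rintro ⟨h0, h1⟩ i hi
      cases i with
      | zero => simpa [hi] using h0
      | succ i => exact h1 i hi
  rw [hpre, Measure.prod_prod, Measure.infinitePi_pi _ fun i _ => ht _]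
  by_cases h0 : 0 ∈ s
  · have hs : s = insert 0 ((s.preimage Nat.succ Nat.succ_injective.injOn).map
        ⟨Nat.succ, Nat.succ_injective⟩) := by
      ext i; cases i <;> simp [h0]
    conv_rhs => rw [hs]
    rw [Finset.prod_insert (by simp), Finset.prod_map]
    simp [h0]
  · have hs : s = (s.preimage Nat.succ Nat.succ_injective.injOn).map
        ⟨Nat.succ, Nat.succ_injective⟩ := by
      ext i; cases i <;> simp [h0]
    conv_rhs => rw [hs]
    rw [Finset.prod_map]
    simp [h0]

/-- The law of a coin showing `true` with probability `t`, truncated to `[0, 1]`. -/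
def coin (t : ℝ) : Measure Bool :=
  ENNReal.ofReal (max 0 (min t 1)) • Measure.dirac true
    + ENNReal.ofReal (1 - max 0 (min t 1)) • Measure.dirac false

instance (t : ℝ) : IsProbabilityMeasure (coin t) := by
  constructor
  simp only [coin, Measure.coe_add, Measure.coe_smul, Pi.add_apply, Pi.smul_apply, measure_univ,
    smul_eq_mul, mul_one]
  rw [← ENNReal.ofReal_add (le_max_left _ _) (by simp), add_sub_cancel, ENNReal.ofReal_one]

lemma coin_eq {t : ℝ} (h0 : 0 ≤ t) (h1 : t ≤ 1) :
    coin t = ENNReal.ofReal t • Measure.dirac true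
      + ENNReal.ofReal (1 - t) • Measure.dirac false := by
  simp [coin, h0, h1]

lemma integral_coin {t : ℝ} (h0 : 0 ≤ t) (h1 : t ≤ 1) (F : Bool → ℝ) :
    ∫ b, F b ∂(coin t) = t * F true + (1 - t) * F false := by
  rw [coin_eq h0 h1, integral_add_measure (Integrable.smul_measure (integrable_dirac (by simp))
    (by simp)) (Integrable.smul_measure (integrable_dirac (by simp)) (by simp)),
    integral_smul_measure, integral_smul_measure]
  simp [h0, h1]

lemma coin_true {t : ℝ} (h0 : 0 ≤ t) (h1 : t ≤ 1) : coin t {true} = ENNReal.ofReal t := by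
  simp [coin_eq h0 h1]

lemma coin_false {t : ℝ} (h0 : 0 ≤ t) (h1 : t ≤ 1) :
    coin t {false} = ENNReal.ofReal (1 - t) := by
  simp [coin_eq h0 h1]

/-- The law of the stack of coins at a site with cookie strengths `q`. -/
def stackLaw (q : ℕ → ℝ) : Measure (ℕ → Bool) := Measure.infinitePi fun i => coin (q i)

instance (q : ℕ → ℝ) : IsProbabilityMeasure (stackLaw q) := by
  unfold stackLaw; infer_instance

/-- The number of successes among the first `n` coins of a stack. -/
def heads (σ : ℕ → Bool) (n : ℕ) : ℕ := Nat.count (fun i => σ i = true) n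

/-- The number of failures before the `r`-th success in a stack of coins. -/
def failures (σ : ℕ → Bool) (r : ℕ) : ℕ := sInf {k | r ≤ heads σ (k + r)}

/-- The stack contains infinitely many successes. -/
def Good (σ : ℕ → Bool) : Prop := ∀ r, ∃ n, r ≤ heads σ n

lemma heads_succ (σ : ℕ → Bool) (n : ℕ) :
    heads σ (n + 1) = heads σ n + if σ n = true then 1 else 0 := Nat.count_succ _ _

lemma heads_le (σ : ℕ → Bool) (n : ℕ) : heads σ n ≤ n := Nat.count_le _

lemma heads_mono (σ : ℕ → Bool) : Monotone (heads σ) := Nat.count_monotone _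

lemma heads_add_le (σ : ℕ → Bool) (n k : ℕ) : heads σ (n + k) ≤ heads σ n + k := by
  unfold heads; rw [Nat.count_add]; gcongr; exact Nat.count_le _

lemma heads_scons (b : Bool) (τ : ℕ → Bool) (n : ℕ) :
    heads (scons b τ) (n + 1) = heads τ n + if b = true then 1 else 0 := Nat.count_succ' _ _

lemma Good.nonempty {σ : ℕ → Bool} (h : Good σ) (r : ℕ) :
    {k | r ≤ heads σ (k + r)}.Nonempty := by
  obtain ⟨n, hn⟩ := h r
  exact ⟨n, hn.trans (heads_mono σ (Nat.le_add_right _ _))⟩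

lemma Good.failures_le_iff {σ : ℕ → Bool} (h : Good σ) {r k : ℕ} :
    failures σ r ≤ k ↔ r ≤ heads σ (k + r) := by
  constructor
  · intro hk
    exact (Nat.sInf_mem (h.nonempty r)).trans (heads_mono σ (Nat.add_le_add_right hk r))
  · exact fun hk => Nat.sInf_le hk

lemma failures_zero (σ : ℕ → Bool) : failures σ 0 = 0 :=
  Nat.le_zero.1 (Nat.sInf_le (by simp))

lemma Good.failures_mono {σ : ℕ → Bool} (h : Good σ) : Monotone (failures σ) := by
  refine monotone_nat_of_le_succ fun r => ?_
  rw [h.failures_le_iff]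
  have h1 := h.failures_le_iff.1 (le_refl (failures σ (r + 1)))
  have h2 := heads_add_le σ (failures σ (r + 1) + r) 1
  rw [← add_assoc] at h1
  omega

lemma failures_scons_true (τ : ℕ → Bool) (r : ℕ) :
    failures (scons true τ) (r + 1) = failures τ r := by
  unfold failures
  congr 1
  ext k
  simp only [Set.mem_ofPred_eq, ← add_assoc, heads_scons]
  simp

lemma failures_scons_false {τ : ℕ → Bool} (h : Good τ) (r : ℕ) :
    failures (scons false τ) (r + 1) = failures τ (r + 1) + 1 := by
  have key : ∀ k, (r + 1 ≤ heads (scons false τ) (k + (r + 1))) ↔ r + 1 ≤ heads τ (k + r) := by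
    intro k; rw [← add_assoc, heads_scons]; simp
  have hg : Good (scons false τ) := by
    intro r'
    obtain ⟨n, hn⟩ := h r'
    exact ⟨n + 1, by rw [heads_scons]; omega⟩
  refine le_antisymm ?_ ?_
  · rw [hg.failures_le_iff, key]
    have := h.failures_le_iff.1 (le_refl (failures τ (r + 1)))
    convert this using 2; ring
  · have h1 := (key _).1 (hg.failures_le_iff.1 (le_refl (failures (scons false τ) (r + 1))))
    cases h2 : failures (scons false τ) (r + 1) with
    | zero => rw [h2] at h1; have := heads_le τ (0 + r); omega
    | succ k =>
      rw [h2] at h1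
      have : failures τ (r + 1) ≤ k := by
        rw [h.failures_le_iff]; convert h1 using 2; ring
      omega

lemma measurable_sInf_nat {α : Type*} [MeasurableSpace α] {p : α → ℕ → Prop}
    (hp : ∀ k, MeasurableSet {a | p a k}) : Measurable fun a => sInf {k | p a k} := by
  refine measurable_to_countable' fun k => ?_
  have : (fun a => sInf {k | p a k}) ⁻¹' {k}
      = ({a | p a k} ∩ ⋂ j ∈ Finset.range k, {a | p a j}ᶜ) ∪
        (if k = 0 then ⋂ j, {a | p a j}ᶜ else ∅) := by
    ext a
    simp only [Set.mem_preimage, Set.mem_singleton_iff, Set.mem_union, Set.mem_inter_iff,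
      Set.mem_ofPred_eq, Set.mem_iInter, Finset.mem_range, Set.mem_compl_iff]
    constructor
    · intro h
      by_cases hne : {k | p a k}.Nonempty
      · left
        rw [← h]
        exact ⟨Nat.sInf_mem hne, fun j hj => Nat.notMem_of_lt_sInf hj⟩
      · right
        rw [Set.not_nonempty_iff_eq_empty] at hne
        rw [hne, Nat.sInf_empty] at h
        rw [if_pos h.symm]
        simp only [Set.mem_iInter, Set.mem_compl_iff]
        exact fun j hj => (Set.eq_empty_iff_forall_notMem.1 hne j) hj
    · rintro (⟨h1, h2⟩ | h)
      · refine le_antisymm (Nat.sInf_le h1) ?_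
        by_contra! hlt
        exact h2 _ hlt (Nat.sInf_mem ⟨k, h1⟩)
      · split_ifs at h with hk
        · simp only [Set.mem_iInter, Set.mem_compl_iff, Set.mem_ofPred_eq] at h
          have : {k | p a k} = ∅ := Set.eq_empty_iff_forall_notMem.2 h
          rw [this, Nat.sInf_empty, hk]
        · exact h.elim
  rw [this]
  refine MeasurableSet.union ((hp k).inter (Finset.measurableSet_biInter _ fun j _ => (hp j).compl))
    ?_
  split_ifs
  · exact MeasurableSet.iInter fun j => (hp j).compl
  · exact MeasurableSet.empty

lemma measurable_heads (n : ℕ) : Measurable fun σ : ℕ → Bool => heads σ n := by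
  induction n with
  | zero => simp [heads]
  | succ n ih =>
    simp only [heads_succ]
    exact ih.add ((measurable_of_countable fun b : Bool => if b = true then 1 else 0).comp
      (measurable_pi_apply n))

lemma measurable_failures (r : ℕ) : Measurable fun σ : ℕ → Bool => failures σ r :=
  measurable_sInf_nat fun k => measurableSet_le measurable_const (measurable_heads (k + r))

/-- Strengths in `[1/2, 1)`, eventually fair. -/
structure IsStrength (M : ℕ) (q : ℕ → ℝ) : Prop where
  half_le : ∀ i, 1 / 2 ≤ q i
  lt_one : ∀ i, q i < 1
  fair : ∀ i, M ≤ i → q i = 1 / 2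

lemma IsStrength.tail {M : ℕ} {q : ℕ → ℝ} (h : IsStrength (M + 1) q) :
    IsStrength M fun i => q (i + 1) :=
  ⟨fun i => h.half_le _, fun i => h.lt_one _, fun i hi => h.fair _ (by omega)⟩

lemma IsStrength.nonneg {M : ℕ} {q : ℕ → ℝ} (h : IsStrength M q) (i : ℕ) : 0 ≤ q i := by
  linarith [h.half_le i]

lemma ae_good {M : ℕ} {q : ℕ → ℝ} (h : IsStrength M q) : ∀ᵐ σ ∂(stackLaw q), Good σ := by
  have hind : iIndepSet (fun n => {σ : ℕ → Bool | σ n = true}) (stackLaw q) := by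
    have := (iIndepFun_infinitePi (P := fun i => coin (q i)) (X := fun _ b => b)
      (fun _ => measurable_id))
    rw [iIndepSet_iff_meas_biInter (fun n => measurableSet_eq_fun (measurable_pi_apply n)
      measurable_const)]
    intro S
    exact (iIndepFun_iff_measure_inter_preimage_eq_mul.1 this) S (sets := fun _ => {true})
      (fun _ _ => MeasurableSet.singleton _)
  have hval : ∀ n, (stackLaw q) {σ : ℕ → Bool | σ n = true} = ENNReal.ofReal (q n) := by
    intro n
    have := Measure.infinitePi_map_eval (fun i => coin (q i)) n
    rw [← coin_true (h.nonneg n) (h.lt_one n).le, ← this,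
      Measure.map_apply (measurable_pi_apply n) (MeasurableSet.singleton _)]
    rfl
  have h1 := measure_limsup_eq_one (fun n => measurableSet_eq_fun (measurable_pi_apply n)
      measurable_const) hind (by
    simp only [hval]
    refine top_le_iff.1 (le_trans (le_of_eq (ENNReal.tsum_const_eq_top_of_ne_zero
      (α := ℕ) (c := ENNReal.ofReal (1 / 2)) (by norm_num)).symm) ?_)
    exact ENNReal.tsum_le_tsum fun n => ENNReal.ofReal_le_ofReal (h.half_le n))
  have h2 : ∀ᵐ σ ∂(stackLaw q), σ ∈ limsup (fun n => {σ : ℕ → Bool | σ n = true}) atTop := by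
    rw [← mem_ae_iff_prob_eq_one₀] at h1
    · exact h1
    · exact (MeasurableSet.measurableSet_limsup fun n => measurableSet_eq_fun
        (measurable_pi_apply n) measurable_const).nullMeasurableSet
  filter_upwards [h2] with σ hσ r
  rw [mem_limsup_iff_frequently_mem] at hσ
  induction r with
  | zero => exact ⟨0, Nat.zero_le _⟩
  | succ r ih =>
    obtain ⟨n, hn⟩ := ih
    obtain ⟨m, hm, hm'⟩ := (frequently_atTop.1 hσ) n
    refine ⟨m + 1, ?_⟩
    have h3 : σ m = true := hm'
    rw [heads_succ, if_pos h3]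
    have := heads_mono σ hm
    omega

/-- `E[s ^ N]` where `N` is the number of failures before the `r`-th success,
for strengths that are fair from index `M` on. -/
def genFun : ℕ → (ℕ → ℝ) → ℕ → ℝ → ℝ
  | 0, _, r, s => (1 / (2 - s)) ^ r
  | _ + 1, _, 0, _ => 1
  | M + 1, q, r + 1, s => q 0 * genFun M (fun i => q (i + 1)) r s
      + (1 - q 0) * (s * genFun M (fun i => q (i + 1)) (r + 1) s)

lemma genFun_zero (M : ℕ) (q : ℕ → ℝ) (s : ℝ) : genFun M q 0 s = 1 := by
  cases M <;> simp [genFun]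

lemma integrable_pow_nat {α : Type*} [MeasurableSpace α] {μ : Measure α} [IsFiniteMeasure μ]
    {N : α → ℕ} (hN : Measurable N) {s : ℝ} (h0 : 0 ≤ s) (h1 : s ≤ 1) :
    Integrable (fun a => s ^ N a) μ := by
  refine Integrable.of_bound ((measurable_of_countable fun n : ℕ => s ^ n).comp
    hN).aestronglyMeasurable 1 (ae_of_all _ fun a => ?_)
  simp only [Real.norm_eq_abs]
  rw [abs_of_nonneg (by positivity)]
  exact pow_le_one₀ h0 h1

lemma integral_stackLaw_succ {M : ℕ} {q : ℕ → ℝ} (h : IsStrength M q) {s : ℝ} (h0 : 0 ≤ s)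
    (h1 : s ≤ 1) (r : ℕ) :
    ∫ σ, s ^ failures σ (r + 1) ∂(stackLaw q)
      = q 0 * ∫ τ, s ^ failures τ r ∂(stackLaw fun i => q (i + 1))
        + (1 - q 0) * (s * ∫ τ, s ^ failures τ (r + 1) ∂(stackLaw fun i => q (i + 1))) := by
  have h' : IsStrength M fun i => q (i + 1) :=
    ⟨fun i => h.half_le _, fun i => h.lt_one _, fun i hi => h.fair _ (by omega)⟩
  have hmeas : Measurable fun σ : ℕ → Bool => s ^ failures σ (r + 1) :=
    (measurable_of_countable fun n : ℕ => s ^ n).comp (measurable_failures _)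
  rw [stackLaw, ← map_scons (fun i => coin (q i)), integral_map measurable_scons.aemeasurable
    hmeas.aestronglyMeasurable]
  rw [integral_prod]
  · rw [integral_coin (h.nonneg 0) (h.lt_one 0).le]
    simp only [failures_scons_true]
    congr 2
    rw [← integral_const_mul]
    refine integral_congr_ae ?_
    filter_upwards [ae_good h'] with τ hτ
    rw [failures_scons_false hτ, pow_succ, mul_comm]
  · exact integrable_pow_nat ((measurable_failures _).comp measurable_scons) h0 h1

lemma integral_pow_failures {M : ℕ} {q : ℕ → ℝ} (h : IsStrength M q) {s : ℝ} (h0 : 0 ≤ s)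
    (h1 : s ≤ 1) (r : ℕ) : ∫ σ, s ^ failures σ r ∂(stackLaw q) = genFun M q r s := by
  induction M generalizing q r with
  | zero =>
    have hq : q = fun _ => 1 / 2 := funext fun i => h.fair i (Nat.zero_le _)
    subst hq
    induction r with
    | zero => simp [failures_zero, genFun]
    | succ r ih =>
      have := integral_stackLaw_succ h h0 h1 r
      rw [ih] at this
      simp only [genFun] at this ⊢
      have h2 : 2 - s ≠ 0 := by linarith
      rw [pow_succ]
      field_simp
      linarith
  | succ M ih =>
    cases r with
    | zero => simp [failures_zero, genFun_zero]
    | succ r => rw [integral_stackLaw_succ h h0 h1, ih h.tail, ih h.tail, genFun]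

lemma stackLaw_all_false {M : ℕ} {q : ℕ → ℝ} (h : IsStrength M q) (L : ℕ) :
    0 < stackLaw q {σ | ∀ i < L, σ i = false} := by
  have : {σ : ℕ → Bool | ∀ i < L, σ i = false}
      = Set.pi (Finset.range L : Set ℕ) fun _ => {false} := by
    ext σ; simp
  rw [this, stackLaw, Measure.infinitePi_pi _ fun _ _ => MeasurableSet.singleton _,
    pos_iff_ne_zero, Finset.prod_ne_zero_iff]
  intro i _
  rw [coin_false (h.nonneg i) (h.lt_one i).le]
  simpa using h.lt_one i

lemma le_failures_of_all_false {σ : ℕ → Bool} (hg : Good σ) {L : ℕ} (h : ∀ i < L, σ i = false) :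
    L ≤ failures σ 1 := by
  have hz : ∀ n ≤ L, heads σ n = 0 := by
    intro n
    induction n with
    | zero => intro _; rfl
    | succ n ih => intro hn; rw [heads_succ, ih (by omega), h n (by omega)]; rfl
  by_contra! hlt
  have := hg.failures_le_iff.1 (le_refl (failures σ 1))
  rw [hz _ hlt] at this
  omega

/-- `φ x = a + b x + c x ^ 2 + O(x ^ 3)` as `x ↓ 0`. -/
def HasExpansion (φ : ℝ → ℝ) (a b c : ℝ) : Prop :=
  (fun x => φ x - (a + b * x + c * x ^ 2)) =O[𝓝[>] 0] fun x => x ^ 3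

namespace HasExpansion

variable {φ ψ : ℝ → ℝ} {a b c a' b' c' : ℝ}

lemma congr_right (h : HasExpansion φ a b c) (ha : a = a') (hb : b = b') (hc : c = c') :
    HasExpansion φ a' b' c' := by subst ha hb hc; exact h

lemma congr_left (h : HasExpansion φ a b c) (hφ : ∀ x, 0 < x → φ x = ψ x) :
    HasExpansion ψ a b c := by
  refine IsBigO.congr' h ?_ EventuallyEq.rfl
  filter_upwards [self_mem_nhdsWithin] with x hx
  rw [hφ x hx]

lemma quadratic (a b c : ℝ) : HasExpansion (fun x => a + b * x + c * x ^ 2) a b c := by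
  simp only [HasExpansion, sub_self]; exact isBigO_zero _ _

lemma add (h : HasExpansion φ a b c) (h' : HasExpansion ψ a' b' c') :
    HasExpansion (fun x => φ x + ψ x) (a + a') (b + b') (c + c') := by
  refine (IsBigO.add h h').congr_left fun x => ?_
  ring

lemma const_mul (h : HasExpansion φ a b c) (k : ℝ) :
    HasExpansion (fun x => k * φ x) (k * a) (k * b) (k * c) := by
  refine (IsBigO.const_mul_left h k).congr_left fun x => ?_
  ring

lemma sub (h : HasExpansion φ a b c) (h' : HasExpansion ψ a' b' c') :
    HasExpansion (fun x => φ x - ψ x) (a - a') (b - b') (c - c') := by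
  refine (IsBigO.sub h h').congr_left fun x => ?_
  ring

lemma sum {ι : Type*} {s : Finset ι} {φ : ι → ℝ → ℝ} {a b c : ι → ℝ}
    (h : ∀ i ∈ s, HasExpansion (φ i) (a i) (b i) (c i)) :
    HasExpansion (fun x => ∑ i ∈ s, φ i x) (∑ i ∈ s, a i) (∑ i ∈ s, b i) (∑ i ∈ s, c i) := by
  refine (IsBigO.sum h).congr_left fun x => ?_
  rw [Finset.sum_apply]
  simp only [Finset.sum_sub_distrib, Finset.sum_add_distrib, Finset.sum_mul]

lemma tendsto (h : HasExpansion φ a b c) : Tendsto φ (𝓝[>] 0) (𝓝 a) := by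
  have h1 : Tendsto (fun x : ℝ => x ^ 3) (𝓝[>] 0) (𝓝 0) := by
    refine tendsto_nhdsWithin_of_tendsto_nhds ?_
    simpa using (continuous_pow 3).tendsto (0 : ℝ)
  have h2 : Tendsto (fun x : ℝ => a + b * x + c * x ^ 2) (𝓝[>] 0) (𝓝 a) := by
    refine tendsto_nhdsWithin_of_tendsto_nhds ?_
    have : Continuous fun x : ℝ => a + b * x + c * x ^ 2 := by fun_prop
    simpa using this.tendsto 0
  simpa using (IsBigO.trans_tendsto h h1).add h2

lemma isBigO_one (h : HasExpansion φ a b c) : φ =O[𝓝[>] 0] fun _ => (1 : ℝ) :=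
  h.tendsto.isBigO_one ℝ

lemma mul (h : HasExpansion φ a b c) (h' : HasExpansion ψ a' b' c') :
    HasExpansion (fun x => φ x * ψ x) (a * a') (a * b' + b * a') (a * c' + b * b' + c * a') := by
  have h1 : (fun x => (φ x - (a + b * x + c * x ^ 2)) * ψ x) =O[𝓝[>] 0] fun x => x ^ 3 := by
    simpa using IsBigO.mul h h'.isBigO_one
  have h2 : (fun x => (a + b * x + c * x ^ 2) * (ψ x - (a' + b' * x + c' * x ^ 2)))
      =O[𝓝[>] 0] fun x => x ^ 3 := by
    simpa using IsBigO.mul (quadratic a b c).isBigO_one h'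
  have h3 : (fun x : ℝ => x ^ 3 * (b * c' + c * b' + c * c' * x)) =O[𝓝[>] 0] fun x => x ^ 3 := by
    have : (fun x : ℝ => b * c' + c * b' + c * c' * x) =O[𝓝[>] 0] fun _ => (1 : ℝ) := by
      simpa using (quadratic (b * c' + c * b') (c * c') 0).isBigO_one
    simpa using (isBigO_refl (fun x : ℝ => x ^ 3) (𝓝[>] 0)).mul this
  refine ((h1.add h2).add h3).congr_left fun x => ?_
  ring

lemma inv_one_add : HasExpansion (fun x => 1 / (1 + x)) 1 (-1) 1 := by
  have h1 : (fun x : ℝ => x ^ 3 * (-(1 / (1 + x)))) =O[𝓝[>] 0] fun x => x ^ 3 := by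
    have : Tendsto (fun x : ℝ => -(1 / (1 + x))) (𝓝[>] 0) (𝓝 (-(1 / (1 + 0)))) := by
      refine tendsto_nhdsWithin_of_tendsto_nhds ?_
      refine (ContinuousAt.neg ?_).tendsto
      exact ContinuousAt.div (by fun_prop) (by fun_prop) (by norm_num)
    simpa using (isBigO_refl (fun x : ℝ => x ^ 3) (𝓝[>] 0)).mul (this.isBigO_one ℝ)
  refine h1.congr' ?_ EventuallyEq.rfl
  filter_upwards [self_mem_nhdsWithin] with x hx
  have : 1 + x ≠ 0 := by have : (0 : ℝ) < x := hx; positivity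
  field_simp
  ring

lemma tendsto_first (h : HasExpansion φ 0 b c) :
    Tendsto (fun x => φ x / x) (𝓝[>] 0) (𝓝 b) := by
  have h1 : (fun x => φ x / x - (b + c * x)) =O[𝓝[>] 0] fun x => x ^ 2 := by
    have := IsBigO.mul h (isBigO_refl (fun x : ℝ => x⁻¹) (𝓝[>] 0))
    refine this.congr' ?_ ?_ <;> filter_upwards [self_mem_nhdsWithin] with x hx <;>
      have hx' : x ≠ 0 := ne_of_gt hx <;> field_simp <;> ring
  have h0 : Tendsto (fun x : ℝ => x ^ 2) (𝓝[>] 0) (𝓝 0) := by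
    refine tendsto_nhdsWithin_of_tendsto_nhds ?_
    simpa using (continuous_pow 2).tendsto (0 : ℝ)
  have h2 : Tendsto (fun x : ℝ => b + c * x) (𝓝[>] 0) (𝓝 b) := by
    refine tendsto_nhdsWithin_of_tendsto_nhds ?_
    have : Continuous fun x : ℝ => b + c * x := by fun_prop
    simpa using this.tendsto 0
  simpa using (IsBigO.trans_tendsto h1 h0).add h2

lemma tendsto_second (h : HasExpansion φ 0 0 c) :
    Tendsto (fun x => φ x / x ^ 2) (𝓝[>] 0) (𝓝 c) := by
  have h1 : (fun x => φ x / x ^ 2 - c) =O[𝓝[>] 0] fun x => x := by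
    have := IsBigO.mul h (isBigO_refl (fun x : ℝ => (x ^ 2)⁻¹) (𝓝[>] 0))
    refine this.congr' ?_ ?_ <;> filter_upwards [self_mem_nhdsWithin] with x hx <;>
      have hx' : x ≠ 0 := ne_of_gt hx <;> field_simp
    ring
  have h0 : Tendsto (fun x : ℝ => x) (𝓝[>] 0) (𝓝 0) :=
    tendsto_nhdsWithin_of_tendsto_nhds tendsto_id
  simpa using (IsBigO.trans_tendsto h1 h0).add (tendsto_const_nhds (x := c))

lemma eq_zero (h : HasExpansion (fun _ => 0) a b c) : a = 0 ∧ b = 0 ∧ c = 0 := by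
  have ha : a = 0 := tendsto_nhds_unique h.tendsto tendsto_const_nhds
  subst ha
  have hb : b = 0 := tendsto_nhds_unique h.tendsto_first (by simp)
  subst hb
  exact ⟨rfl, rfl, tendsto_nhds_unique h.tendsto_second (by simp)⟩

end HasExpansion

/-- The expected number of failures before the `r`-th success. -/
def mean : ℕ → (ℕ → ℝ) → ℕ → ℝ
  | 0, _, r => r
  | _ + 1, _, 0 => 0
  | M + 1, q, r + 1 => q 0 * mean M (fun i => q (i + 1)) r
      + (1 - q 0) * (1 + mean M (fun i => q (i + 1)) (r + 1))

/-- The second binomial moment of the number of failures before the `r`-th success. -/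
def binom2 : ℕ → (ℕ → ℝ) → ℕ → ℝ
  | 0, _, r => r * (r + 1) / 2
  | _ + 1, _, 0 => 0
  | M + 1, q, r + 1 => q 0 * binom2 M (fun i => q (i + 1)) r
      + (1 - q 0) * (binom2 M (fun i => q (i + 1)) (r + 1) + mean M (fun i => q (i + 1)) (r + 1))

/-- The value of `genFun M q r (1 - x)` when all `M` cookies are certainly used. -/
def fullGenFun : ℕ → (ℕ → ℝ) → ℕ → ℝ → ℝ
  | 0, _, r, x => (1 / (1 + x)) ^ r
  | M + 1, q, r, x => (1 + (2 * q 0 - 1) * x) * fullGenFun M (fun i => q (i + 1)) r x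

/-- First-order coefficient of `fullGenFun`, up to sign. -/
def fullMean : ℕ → (ℕ → ℝ) → ℕ → ℝ
  | 0, _, r => r
  | M + 1, q, r => fullMean M (fun i => q (i + 1)) r - (2 * q 0 - 1)

/-- Second-order coefficient of `fullGenFun`. -/
def fullBinom2 : ℕ → (ℕ → ℝ) → ℕ → ℝ
  | 0, _, r => r * (r + 1) / 2
  | M + 1, q, r => fullBinom2 M (fun i => q (i + 1)) r
      - (2 * q 0 - 1) * fullMean M (fun i => q (i + 1)) r

lemma hasExpansion_inv_pow (r : ℕ) :
    HasExpansion (fun x => (1 / (1 + x)) ^ r) 1 (-r) (r * (r + 1) / 2) := by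
  induction r with
  | zero => simpa using HasExpansion.quadratic 1 0 0
  | succ r ih =>
    refine ((ih.mul HasExpansion.inv_one_add).congr_right ?_ ?_ ?_).congr_left ?_
    · ring
    · push_cast; ring
    · push_cast; ring
    · intro x _; rw [pow_succ]

lemma hasExpansion_genFun (M : ℕ) (q : ℕ → ℝ) (r : ℕ) :
    HasExpansion (fun x => genFun M q r (1 - x)) 1 (-mean M q r) (binom2 M q r) := by
  induction M generalizing q r with
  | zero =>
    refine (hasExpansion_inv_pow r).congr_left fun x _ => ?_
    simp only [genFun]; congr 2; ring
  | succ M ih =>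
    cases r with
    | zero => simpa [genFun, mean, binom2] using HasExpansion.quadratic 1 0 0
    | succ r =>
      have h1 := (ih (fun i => q (i + 1)) r).const_mul (q 0)
      have h2 := (((HasExpansion.quadratic 1 (-1) 0).mul
        (ih (fun i => q (i + 1)) (r + 1))).const_mul (1 - q 0))
      refine ((h1.add h2).congr_right ?_ ?_ ?_).congr_left fun x _ => ?_
      · ring
      · simp only [mean]; ring
      · simp only [binom2]; ring
      · simp only [genFun]; ring

lemma hasExpansion_fullGenFun (M : ℕ) (q : ℕ → ℝ) (r : ℕ) :
    HasExpansion (fullGenFun M q r) 1 (-fullMean M q r) (fullBinom2 M q r) := by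
  induction M generalizing q with
  | zero => exact (hasExpansion_inv_pow r).congr_left fun x _ => rfl
  | succ M ih =>
    refine (((HasExpansion.quadratic 1 (2 * q 0 - 1) 0).mul
      (ih fun i => q (i + 1))).congr_right ?_ ?_ ?_).congr_left fun x _ => ?_
    · ring
    · simp only [fullMean]; ring
    · simp only [fullBinom2]; ring
    · simp only [fullGenFun]; ring

lemma fullGenFun_add (M : ℕ) (q : ℕ → ℝ) (r k : ℕ) (x : ℝ) :
    fullGenFun M q (r + k) x = fullGenFun M q r x * (1 / (1 + x)) ^ k := by
  induction M generalizing q with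
  | zero => simp only [fullGenFun, pow_add]
  | succ M ih => simp only [fullGenFun, ih]; ring

lemma genFun_eq_fullGenFun {M : ℕ} {q : ℕ → ℝ} {r : ℕ}
    (h : ∀ i, r ≤ i → i < M → q i = 1 / 2) {x : ℝ} (hx : 0 ≤ x) :
    genFun M q r (1 - x) = fullGenFun M q r x := by
  induction M generalizing q r with
  | zero => simp only [genFun, fullGenFun]; congr 2; ring
  | succ M ih =>
    cases r with
    | zero =>
      rw [genFun_zero]
      have := ih (q := fun i => q (i + 1)) (r := 0) fun i _ hi => h _ (by omega) (by omega)
      rw [genFun_zero] at this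
      rw [fullGenFun, ← this, h 0 le_rfl (by omega)]
      ring
    | succ r =>
      have h1 := ih (q := fun i => q (i + 1)) (r := r) fun i _ hi => h _ (by omega) (by omega)
      have h2 := ih (q := fun i => q (i + 1)) (r := r + 1) fun i _ hi => h _ (by omega) (by omega)
      rw [genFun, fullGenFun, h1, h2, fullGenFun_add, pow_one]
      have : 1 + x ≠ 0 := by positivity
      field_simp
      ring

/-- The boundary correction when `j + 1` successes are awaited. -/
def excess (M : ℕ) (q : ℕ → ℝ) (j : ℕ) (x : ℝ) : ℝ :=
  genFun M q (j + 1) (1 - x) - fullGenFun M q (j + 1) x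

/-- The increments of the boundary corrections. -/
def excessDiff (M : ℕ) (q : ℕ → ℝ) (j : ℕ) (x : ℝ) : ℝ :=
  excess M q j x - excess M q (j + 1) x

/-- First-order coefficient of `excessDiff`, up to sign. -/
def gap (M : ℕ) (q : ℕ → ℝ) (j : ℕ) : ℝ :=
  (mean M q (j + 1) - fullMean M q (j + 1)) - (mean M q (j + 2) - fullMean M q (j + 2))

/-- Second-order coefficient of `excessDiff`. -/
def gap2 (M : ℕ) (q : ℕ → ℝ) (j : ℕ) : ℝ :=
  (binom2 M q (j + 1) - fullBinom2 M q (j + 1)) - (binom2 M q (j + 2) - fullBinom2 M q (j + 2))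

lemma hasExpansion_excessDiff (M : ℕ) (q : ℕ → ℝ) (j : ℕ) :
    HasExpansion (excessDiff M q j) 0 (-gap M q j) (gap2 M q j) := by
  refine ((((hasExpansion_genFun M q (j + 1)).sub (hasExpansion_fullGenFun M q (j + 1))).sub
    ((hasExpansion_genFun M q (j + 2)).sub (hasExpansion_fullGenFun M q (j + 2)))).congr_right
    ?_ ?_ ?_).congr_left fun x _ => ?_
  · ring
  · simp only [gap]; ring
  · simp only [gap2]
  · simp only [excessDiff, excess]

lemma excess_eq_zero {M : ℕ} {q : ℕ → ℝ} {j : ℕ} (h : ∀ i, j + 1 ≤ i → i < M → q i = 1 / 2)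
    {x : ℝ} (hx : 0 ≤ x) : excess M q j x = 0 := by
  rw [excess, genFun_eq_fullGenFun h hx, sub_self]

lemma sum_excessDiff {M : ℕ} {q : ℕ → ℝ} {x : ℝ} (hx : 0 ≤ x) (z : ℕ) :
    excess M q z x = ∑ j ∈ Finset.range M, if z ≤ j then excessDiff M q j x else 0 := by
  have hM : ∀ j, M ≤ j → excess M q j x = 0 := fun j hj =>
    excess_eq_zero (fun i hi hi' => by omega) hx
  rcases le_or_gt M z with h | h
  · rw [hM z h, Finset.sum_eq_zero]
    intro j hj
    rw [Finset.mem_range] at hj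
    rw [if_neg (by omega)]
  · obtain ⟨k, rfl⟩ := Nat.exists_eq_add_of_le h.le
    rw [Finset.sum_range_add, Finset.sum_eq_zero, zero_add]
    · rw [Finset.sum_congr rfl fun i _ => if_pos (Nat.le_add_right z i)]
      simp only [excessDiff, add_assoc z]
      rw [Finset.sum_range_sub' (fun i => excess (z + k) q (z + i) x), hM _ le_rfl]
      simp
    · intro j hj
      rw [Finset.mem_range] at hj
      rw [if_neg (by omega)]

lemma genFun_decomp {M : ℕ} {q : ℕ → ℝ} {x : ℝ} (hx : 0 ≤ x) (z : ℕ) :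
    genFun M q (z + 1) (1 - x) = fullGenFun M q 1 x * (1 / (1 + x)) ^ z
      + ∑ j ∈ Finset.range M, if z ≤ j then excessDiff M q j x else 0 := by
  rw [← sum_excessDiff hx, excess, ← fullGenFun_add, add_comm 1 z]; ring

lemma fullMean_succ (M : ℕ) (q : ℕ → ℝ) (r : ℕ) :
    fullMean M q (r + 1) = fullMean M q r + 1 := by
  induction M generalizing q with
  | zero => simp [fullMean]
  | succ M ih => simp only [fullMean, ih]; ring

lemma gap_eq (M : ℕ) (q : ℕ → ℝ) (j : ℕ) :
    gap M q j = 1 - (mean M q (j + 2) - mean M q (j + 1)) := by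
  rw [gap, fullMean_succ M q (j + 1)]; ring

lemma mean_zero (M : ℕ) (q : ℕ → ℝ) : mean M q 0 = 0 := by cases M <;> simp [mean]

lemma mean_diff_le {M : ℕ} {q : ℕ → ℝ} (h : IsStrength M q) (r : ℕ) :
    mean M q (r + 1) - mean M q r ≤ 1 := by
  induction M generalizing q r with
  | zero => simp [mean]
  | succ M ih =>
    have a0 := h.half_le 0
    have b0 := (h.lt_one 0).le
    cases r with
    | zero =>
      have := ih h.tail 0
      simp only [mean, mean_zero] at this ⊢
      nlinarith
    | succ r =>
      have h1 := ih h.tail r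
      have h2 := ih h.tail (r + 1)
      simp only [mean] at h1 h2 ⊢
      nlinarith

lemma fair_of_mean_diff_eq {M : ℕ} {q : ℕ → ℝ} (h : IsStrength M q) {r : ℕ}
    (he : mean M q (r + 1) - mean M q r = 1) : ∀ i, r ≤ i → q i = 1 / 2 := by
  induction M generalizing q r with
  | zero => exact fun i _ => h.fair i (Nat.zero_le _)
  | succ M ih =>
    have a0 := h.half_le 0
    have b0 := (h.lt_one 0).le
    cases r with
    | zero =>
      have := mean_diff_le h.tail 0
      simp only [mean, mean_zero] at this he
      have e1 : q 0 = 1 / 2 := by nlinarith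
      have e2 : mean M (fun i => q (i + 1)) 1 = 1 := by rw [e1] at he; linarith
      intro i _
      cases i with
      | zero => exact e1
      | succ i => exact ih h.tail (r := 0) (by simp [mean_zero, e2]) i (Nat.zero_le _)
    | succ r =>
      have h1 := mean_diff_le h.tail r
      have h2 := mean_diff_le h.tail (r + 1)
      simp only [mean] at h1 h2 he
      intro i hi
      cases i with
      | zero => omega
      | succ i => exact ih h.tail (r := r) (by nlinarith) i (by omega)

lemma gap_nonneg {M : ℕ} {q : ℕ → ℝ} (h : IsStrength M q) (j : ℕ) : 0 ≤ gap M q j := by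
  rw [gap_eq]; linarith [mean_diff_le h (j + 1)]

lemma gap2_eq_zero {M : ℕ} {q : ℕ → ℝ} (h : IsStrength M q) {j : ℕ} (hg : gap M q j = 0) :
    gap2 M q j = 0 := by
  have hf := fair_of_mean_diff_eq h (r := j + 1) (by rw [gap_eq] at hg; linarith)
  have : HasExpansion (fun _ => 0) 0 (-gap M q j) (gap2 M q j) := by
    refine (hasExpansion_excessDiff M q j).congr_left fun x hx => ?_
    rw [excessDiff, excess_eq_zero (fun i hi _ => hf i hi) hx.le,
      excess_eq_zero (fun i hi _ => hf i (by omega)) hx.le, sub_zero]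
  exact this.eq_zero.2.2

lemma half_pow_le_genFun {M : ℕ} {q : ℕ → ℝ} (h : IsStrength M q) (r : ℕ) {s : ℝ} (h0 : 0 ≤ s)
    (h1 : s ≤ 1) : (1 / 2) ^ r ≤ genFun M q r s := by
  induction M generalizing q r with
  | zero =>
    rw [genFun]
    gcongr
    · linarith
    · linarith
  | succ M ih =>
    cases r with
    | zero => simp [genFun]
    | succ r =>
      have a0 := h.half_le 0
      have b0 := (h.lt_one 0).le
      have i1 := ih h.tail r
      have i2 := ih h.tail (r + 1)
      have p1 : (0 : ℝ) < (1 / 2) ^ r := by positivity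
      have p2 : (0 : ℝ) < (1 / 2) ^ (r + 1) := by positivity
      rw [genFun]
      have : 0 ≤ (1 - q 0) * (s * genFun M (fun i => q (i + 1)) (r + 1) s) := by
        refine mul_nonneg (by linarith) (mul_nonneg h0 (by linarith))
      rw [pow_succ]
      nlinarith

lemma continuous_mean_binom2 (M r : ℕ) :
    Continuous (fun q => mean M q r) ∧ Continuous (fun q => binom2 M q r) := by
  have hshift : Continuous fun (q : ℕ → ℝ) (i : ℕ) => q (i + 1) := by fun_prop
  induction M generalizing r with
  | zero => simp only [mean, binom2]; exact ⟨continuous_const, continuous_const⟩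
  | succ M ih =>
    cases r with
    | zero => simp only [mean, binom2]; exact ⟨continuous_const, continuous_const⟩
    | succ r =>
      have a1 := (ih r).1.comp hshift
      have a2 := (ih (r + 1)).1.comp hshift
      have b1 := (ih r).2.comp hshift
      have b2 := (ih (r + 1)).2.comp hshift
      simp only [Function.comp_def] at a1 a2 b1 b2
      simp only [mean, binom2]
      constructor <;> fun_prop

lemma continuous_fullMean_fullBinom2 (M r : ℕ) :
    Continuous (fun q => fullMean M q r) ∧ Continuous (fun q => fullBinom2 M q r) := by
  have hshift : Continuous fun (q : ℕ → ℝ) (i : ℕ) => q (i + 1) := by fun_prop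
  induction M with
  | zero => simp only [fullMean, fullBinom2]; exact ⟨continuous_const, continuous_const⟩
  | succ M ih =>
    have a1 := ih.1.comp hshift
    have b1 := ih.2.comp hshift
    simp only [Function.comp_def] at a1 b1
    simp only [fullMean, fullBinom2]
    constructor <;> fun_prop

lemma continuous_gap (M j : ℕ) : Continuous fun q => gap M q j :=
  ((continuous_mean_binom2 M _).1.sub (continuous_fullMean_fullBinom2 M _).1).sub
    ((continuous_mean_binom2 M _).1.sub (continuous_fullMean_fullBinom2 M _).1)

lemma continuous_gap2 (M j : ℕ) : Continuous fun q => gap2 M q j :=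
  ((continuous_mean_binom2 M _).2.sub (continuous_fullMean_fullBinom2 M _).2).sub
    ((continuous_mean_binom2 M _).2.sub (continuous_fullMean_fullBinom2 M _).2)

lemma continuous_genFun (M r : ℕ) (s : ℝ) : Continuous fun q => genFun M q r s := by
  have hshift : Continuous fun (q : ℕ → ℝ) (i : ℕ) => q (i + 1) := by fun_prop
  induction M generalizing r with
  | zero => simp only [genFun]; exact continuous_const
  | succ M ih =>
    cases r with
    | zero => simp only [genFun]; exact continuous_const
    | succ r =>
      have a1 := (ih r).comp hshift
      have a2 := (ih (r + 1)).comp hshift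
      simp only [Function.comp_def] at a1 a2
      simp only [genFun]
      fun_prop

lemma continuous_fullGenFun (M r : ℕ) (x : ℝ) : Continuous fun q => fullGenFun M q r x := by
  have hshift : Continuous fun (q : ℕ → ℝ) (i : ℕ) => q (i + 1) := by fun_prop
  induction M with
  | zero => simp only [fullGenFun]; exact continuous_const
  | succ M ih =>
    have a1 := ih.comp hshift
    simp only [Function.comp_def] at a1
    simp only [fullGenFun]
    fun_prop

lemma continuous_excessDiff (M j : ℕ) (x : ℝ) : Continuous fun q => excessDiff M q j x :=
  ((continuous_genFun M _ _).sub (continuous_fullGenFun M _ _)).sub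
    ((continuous_genFun M _ _).sub (continuous_fullGenFun M _ _))

/-- The number of failures at the first of `k + 1` consecutive sites, if each site awaits one
success more than the number of failures at the next site and the last site sees none. -/
def backlog : ℕ → (ℕ → ℕ → Bool) → ℕ
  | 0, _ => 0
  | k + 1, τ => failures (τ 0) (backlog k (fun i => τ (i + 1)) + 1)

/-- The law of independent stacks of coins indexed by `ℕ`. -/
def stacksLaw (q : ℕ → ℝ) : Measure (ℕ → ℕ → Bool) := Measure.infinitePi fun _ => stackLaw q

instance (q : ℕ → ℝ) : IsProbabilityMeasure (stacksLaw q) := by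
  unfold stacksLaw; infer_instance

lemma measurable_failures_comp {α : Type*} [MeasurableSpace α] {f : α → ℕ → Bool} {r : α → ℕ}
    (hf : Measurable f) (hr : Measurable r) : Measurable fun a => failures (f a) (r a) :=
  measurable_from_prod_countable_left (f := fun z : (ℕ → Bool) × ℕ => failures z.1 z.2)
    measurable_failures |>.comp (hf.prodMk hr)

lemma measurable_backlog (k : ℕ) : Measurable (backlog k) := by
  induction k with
  | zero => exact measurable_const
  | succ k ih =>
    refine measurable_failures_comp (measurable_pi_apply 0) ?_
    exact (ih.comp (measurable_pi_lambda _ fun i => measurable_pi_apply (i + 1))).add_const 1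

lemma backlog_le_succ {τ : ℕ → ℕ → Bool} (h : ∀ i, Good (τ i)) (k : ℕ) :
    backlog k τ ≤ backlog (k + 1) τ := by
  induction k generalizing τ with
  | zero => exact Nat.zero_le _
  | succ k ih => exact (h 0).failures_mono (Nat.add_le_add_right (ih fun i => h (i + 1)) 1)

lemma ae_forall_good {M : ℕ} {q : ℕ → ℝ} (h : IsStrength M q) :
    ∀ᵐ τ ∂stacksLaw q, ∀ i, Good (τ i) := by
  rw [ae_all_iff]
  intro i
  have := Measure.infinitePi_map_eval (fun _ : ℕ => stackLaw q) i
  have h2 := ae_good h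
  rw [← this] at h2
  exact ae_of_ae_map (measurable_pi_apply i).aemeasurable h2

lemma ae_monotone_backlog {M : ℕ} {q : ℕ → ℝ} (h : IsStrength M q) :
    ∀ᵐ τ ∂stacksLaw q, Monotone fun k => backlog k τ := by
  filter_upwards [ae_forall_good h] with τ hτ
  exact monotone_nat_of_le_succ (backlog_le_succ hτ)

lemma map_backlog_succ (q : ℕ → ℝ) (k : ℕ) :
    (stacksLaw q).map (backlog (k + 1)) = ((stackLaw q).prod (stacksLaw q)).map
      fun z => failures z.1 (backlog k z.2 + 1) := by
  conv_lhs => rw [stacksLaw, ← map_scons (fun _ : ℕ => stackLaw q)]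
  rw [Measure.map_map (measurable_backlog _) measurable_scons]
  rfl

lemma measurable_failures_backlog (k : ℕ) :
    Measurable fun z : (ℕ → Bool) × (ℕ → ℕ → Bool) => failures z.1 (backlog k z.2 + 1) :=
  measurable_failures_comp measurable_fst
    (((measurable_backlog k).comp measurable_snd).add_const 1)

lemma integral_backlog_succ (q : ℕ → ℝ) (k : ℕ) {f : ℕ → ℝ}
    (hf : Integrable (fun τ => f (backlog (k + 1) τ)) (stacksLaw q)) :
    Integrable (fun τ => ∫ σ, f (failures σ (backlog k τ + 1)) ∂stackLaw q) (stacksLaw q) ∧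
    ∫ τ, f (backlog (k + 1) τ) ∂stacksLaw q
      = ∫ τ, ∫ σ, f (failures σ (backlog k τ + 1)) ∂stackLaw q ∂stacksLaw q := by
  have hm : ∀ (ν : Measure ℕ), AEStronglyMeasurable f ν :=
    fun ν => (measurable_of_countable f).aestronglyMeasurable
  have h1 : Integrable f ((stacksLaw q).map (backlog (k + 1))) :=
    (integrable_map_measure (hm _) (measurable_backlog _).aemeasurable).2 hf
  rw [map_backlog_succ] at h1
  have h2 := (integrable_map_measure (hm _) (measurable_failures_backlog k).aemeasurable).1 h1
  refine ⟨h2.integral_prod_right, ?_⟩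
  rw [← integral_map (measurable_backlog _).aemeasurable (hm _), map_backlog_succ,
    integral_map (measurable_failures_backlog k).aemeasurable (hm _)]
  exact integral_prod_symm _ h2

/-- The generating function of `backlog k`. -/
def backlogGen (q : ℕ → ℝ) (k : ℕ) (s : ℝ) : ℝ := ∫ τ, s ^ backlog k τ ∂stacksLaw q

/-- The distribution function of `backlog k`. -/
def backlogCdf (q : ℕ → ℝ) (k j : ℕ) : ℝ := (stacksLaw q).real {τ | backlog k τ ≤ j}

lemma backlogGen_succ_eq_integral {M : ℕ} {q : ℕ → ℝ} (h : IsStrength M q) (k : ℕ) {s : ℝ}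
    (h0 : 0 ≤ s) (h1 : s ≤ 1) :
    Integrable (fun τ => genFun M q (backlog k τ + 1) s) (stacksLaw q) ∧
    backlogGen q (k + 1) s = ∫ τ, genFun M q (backlog k τ + 1) s ∂stacksLaw q := by
  have := integral_backlog_succ q k (f := fun n => s ^ n)
    (integrable_pow_nat (measurable_backlog _) h0 h1)
  simp only [integral_pow_failures h h0 h1] at this
  exact this

lemma measurableSet_backlog_le (k j : ℕ) : MeasurableSet {τ | backlog k τ ≤ j} :=
  measurableSet_le (measurable_backlog k) measurable_const

lemma backlogGen_succ {M : ℕ} {q : ℕ → ℝ} (h : IsStrength M q) (k : ℕ) {x : ℝ}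
    (h0 : 0 ≤ x) (h1 : x ≤ 1) :
    backlogGen q (k + 1) (1 - x) = fullGenFun M q 1 x * backlogGen q k (1 / (1 + x))
      + ∑ j ∈ Finset.range M, backlogCdf q k j * excessDiff M q j x := by
  rw [(backlogGen_succ_eq_integral h k (by linarith) (by linarith)).2]
  simp only [genFun_decomp h0]
  have hi : ∀ j, Integrable (fun τ => if backlog k τ ≤ j then excessDiff M q j x else 0)
      (stacksLaw q) := fun j => by
    have := (integrable_const (μ := stacksLaw q) (excessDiff M q j x)).indicator
      (measurableSet_backlog_le k j)
    refine this.congr (ae_of_all _ fun τ => ?_)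
    simp only [Set.indicator_apply, Set.mem_ofPred_eq]
  rw [integral_add, integral_const_mul, integral_finsetSum]
  · congr 1
    refine Finset.sum_congr rfl fun j _ => ?_
    have := integral_indicator_const (μ := stacksLaw q) (excessDiff M q j x)
      (measurableSet_backlog_le k j)
    rw [backlogCdf, ← smul_eq_mul, ← this]
    simp only [Set.indicator_apply, Set.mem_ofPred_eq]
  · exact fun j _ => hi j
  · exact (integrable_pow_nat (measurable_backlog k) (by positivity)
      (by rw [div_le_one (by linarith)]; linarith)).const_mul _
  · exact integrable_finsetSum _ fun j _ => hi j

lemma backlogGen_antitone {M : ℕ} {q : ℕ → ℝ} (h : IsStrength M q) {s : ℝ} (h0 : 0 ≤ s)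
    (h1 : s ≤ 1) : Antitone fun k => backlogGen q k s := by
  intro k l hkl
  refine integral_mono_ae (integrable_pow_nat (measurable_backlog l) h0 h1)
    (integrable_pow_nat (measurable_backlog k) h0 h1) ?_
  filter_upwards [ae_monotone_backlog h] with τ hτ
  exact pow_le_pow_of_le_one h0 h1 (hτ hkl)

lemma backlogCdf_antitone {M : ℕ} {q : ℕ → ℝ} (h : IsStrength M q) (j : ℕ) :
    Antitone fun k => backlogCdf q k j := by
  intro k l hkl
  refine ENNReal.toReal_mono (measure_ne_top _ _) (measure_mono_ae ?_)
  filter_upwards [ae_monotone_backlog h] with τ hτ hl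
  exact le_trans (hτ hkl) hl

lemma backlogCdf_nonneg (q : ℕ → ℝ) (k j : ℕ) : 0 ≤ backlogCdf q k j := measureReal_nonneg

lemma backlogCdf_le_one (q : ℕ → ℝ) (k j : ℕ) : backlogCdf q k j ≤ 1 := measureReal_le_one

lemma backlogGen_nonneg (q : ℕ → ℝ) (k : ℕ) {s : ℝ} (h0 : 0 ≤ s) : 0 ≤ backlogGen q k s :=
  integral_nonneg fun τ => by positivity

/-- The limiting distribution function of the backlog. -/
def limitCdf (q : ℕ → ℝ) (j : ℕ) : ℝ := ⨅ k, backlogCdf q k j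

/-- The limiting generating function of the backlog. -/
def limitGen (q : ℕ → ℝ) (s : ℝ) : ℝ := ⨅ k, backlogGen q k s

lemma bddBelow_backlogCdf (q : ℕ → ℝ) (j : ℕ) : BddBelow (Set.range fun k => backlogCdf q k j) :=
  ⟨0, by rintro _ ⟨k, rfl⟩; exact backlogCdf_nonneg q k j⟩

lemma limitCdf_le (q : ℕ → ℝ) (k j : ℕ) : limitCdf q j ≤ backlogCdf q k j :=
  ciInf_le (bddBelow_backlogCdf q j) k

lemma limitCdf_nonneg (q : ℕ → ℝ) (j : ℕ) : 0 ≤ limitCdf q j :=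
  le_ciInf fun k => backlogCdf_nonneg q k j

lemma tendsto_backlogCdf {M : ℕ} {q : ℕ → ℝ} (h : IsStrength M q) (j : ℕ) :
    Tendsto (fun k => backlogCdf q k j) atTop (𝓝 (limitCdf q j)) :=
  tendsto_atTop_ciInf (backlogCdf_antitone h j) (bddBelow_backlogCdf q j)

lemma tendsto_backlogGen {M : ℕ} {q : ℕ → ℝ} (h : IsStrength M q) {s : ℝ} (h0 : 0 ≤ s)
    (h1 : s ≤ 1) : Tendsto (fun k => backlogGen q k s) atTop (𝓝 (limitGen q s)) :=
  tendsto_atTop_ciInf (backlogGen_antitone h h0 h1)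
    ⟨0, by rintro _ ⟨k, rfl⟩; exact backlogGen_nonneg q k h0⟩

lemma limitGen_eq {M : ℕ} {q : ℕ → ℝ} (h : IsStrength M q) {x : ℝ} (h0 : 0 ≤ x) (h1 : x ≤ 1) :
    limitGen q (1 - x) = fullGenFun M q 1 x * limitGen q (1 / (1 + x))
      + ∑ j ∈ Finset.range M, limitCdf q j * excessDiff M q j x := by
  have t1 := (tendsto_backlogGen h (s := 1 - x) (by linarith) (by linarith)).comp
    (tendsto_add_atTop_nat 1)
  refine tendsto_nhds_unique t1 ?_
  simp only [Function.comp_def, backlogGen_succ h _ h0 h1]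
  refine ((tendsto_backlogGen h (by positivity)
    (by rw [div_le_one (by linarith)]; linarith)).const_mul _).add ?_
  exact tendsto_finsetSum _ fun j _ => (tendsto_backlogCdf h j).mul_const _

lemma integrable_of_monotone_tendsto {α : Type*} [MeasurableSpace α] {μ : Measure α}
    {f : ℕ → α → ℝ} {F : α → ℝ} {A : ℝ} (hf : ∀ n, Integrable (f n) μ) (h0 : ∀ n ω, 0 ≤ f n ω)
    (hmono : ∀ ω, Monotone fun n => f n ω) (hlim : ∀ ω, Tendsto (fun n => f n ω) atTop (𝓝 (F ω)))
    (hA : Tendsto (fun n => ∫ ω, f n ω ∂μ) atTop (𝓝 A)) :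
    Integrable F μ ∧ ∫ ω, F ω ∂μ = A := by
  have hF : Integrable F μ := by
    have : Tendsto (fun n => ∫⁻ ω, ‖f n ω‖ₑ ∂μ) atTop (𝓝 (ENNReal.ofReal A)) := by
      refine (ENNReal.tendsto_ofReal hA).congr fun n => ?_
      rw [ofReal_integral_eq_lintegral_ofReal (hf n) (ae_of_all _ (h0 n))]
      exact lintegral_congr fun ω => (Real.enorm_of_nonneg (h0 n ω)).symm
    refine ⟨aestronglyMeasurable_of_tendsto_ae atTop (fun n => (hf n).aestronglyMeasurable)
      (ae_of_all _ hlim), ?_⟩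
    calc ∫⁻ ω, ‖F ω‖ₑ ∂μ = ∫⁻ ω, liminf (fun n => ‖f n ω‖ₑ) atTop ∂μ :=
          lintegral_congr fun ω => (hlim ω).enorm.liminf_eq.symm
      _ ≤ liminf (fun n => ∫⁻ ω, ‖f n ω‖ₑ ∂μ) atTop :=
          lintegral_liminf_le' fun n => (hf n).aestronglyMeasurable.aemeasurable.enorm
      _ = ENNReal.ofReal A := this.liminf_eq
      _ < ⊤ := ENNReal.ofReal_lt_top
  exact ⟨hF, tendsto_nhds_unique (integral_tendsto_of_tendsto_of_monotone hf hF
    (ae_of_all _ hmono) (ae_of_all _ hlim)) hA⟩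

/-- `∑_{i < N} t ^ i`. -/
def geom1 (t : ℝ) (N : ℕ) : ℝ := ∑ i ∈ Finset.range N, t ^ i

/-- `∑_{j < i < N} t ^ j`. -/
def geom2 (t : ℝ) (N : ℕ) : ℝ := ∑ i ∈ Finset.range N, geom1 t i

lemma one_sub_mul_geom1 (t : ℝ) (N : ℕ) : (1 - t) * geom1 t N = 1 - t ^ N := by
  rw [geom1, mul_comm, geom_sum_mul_neg]

lemma one_sub_mul_geom2 (t : ℝ) (N : ℕ) : (1 - t) * geom2 t N = N - geom1 t N := by
  rw [geom2, Finset.mul_sum]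
  simp only [one_sub_mul_geom1, Finset.sum_sub_distrib]
  simp [geom1]

lemma geom1_nonneg {t : ℝ} (h : 0 ≤ t) (N : ℕ) : 0 ≤ geom1 t N :=
  Finset.sum_nonneg fun i _ => pow_nonneg h i

lemma geom1_mono {s t : ℝ} (h : 0 ≤ s) (hst : s ≤ t) (N : ℕ) : geom1 s N ≤ geom1 t N :=
  Finset.sum_le_sum fun i _ => pow_le_pow_left₀ h hst i

lemma geom1_one (N : ℕ) : geom1 1 N = N := by simp [geom1]

lemma geom2_one (N : ℕ) : geom2 1 N = N * (N - 1) / 2 := by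
  induction N with
  | zero => simp [geom2]
  | succ N ih =>
    rw [geom2] at ih
    rw [geom2, Finset.sum_range_succ, ih, geom1_one]; push_cast; ring

lemma tendsto_geom1 {t : ℕ → ℝ} {s : ℝ} (h : Tendsto t atTop (𝓝 s)) (N : ℕ) :
    Tendsto (fun n => geom1 (t n) N) atTop (𝓝 (geom1 s N)) :=
  tendsto_finsetSum _ fun i _ => h.pow i

/-- The points `1 - 1 / (n + 1)`. -/
def nearOne (n : ℕ) : ℝ := 1 - 1 / (n + 1)

lemma nearOne_nonneg (n : ℕ) : 0 ≤ nearOne n := by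
  rw [nearOne, sub_nonneg, div_le_one (by positivity)]; linarith [n.cast_nonneg (α := ℝ)]

lemma nearOne_lt_one (n : ℕ) : nearOne n < 1 := by
  rw [nearOne]; linarith [show (0 : ℝ) < 1 / (n + 1) by positivity]

lemma one_sub_nearOne (n : ℕ) : 1 - nearOne n = 1 / (n + 1) := by rw [nearOne]; ring

lemma nearOne_mono : Monotone nearOne := fun m n h => by
  simp only [nearOne]; gcongr

lemma tendsto_inv_nat : Tendsto (fun n : ℕ => 1 / ((n : ℝ) + 1)) atTop (𝓝[>] 0) :=
  tendsto_nhdsWithin_iff.2 ⟨tendsto_one_div_add_atTop_nhds_zero_nat,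
    Eventually.of_forall fun n => by simp only [Set.mem_Ioi]; positivity⟩

lemma tendsto_nearOne : Tendsto nearOne atTop (𝓝 1) := by
  have := (tendsto_const_nhds (x := (1 : ℝ))).sub
    (tendsto_one_div_add_atTop_nhds_zero_nat (𝕜 := ℝ))
  rwa [sub_zero] at this

/-- The first two moments of an integer variable, from its generating function at `1`. -/
lemma moments_of_hasExpansion {α : Type*} [MeasurableSpace α] {μ : Measure α}
    [IsProbabilityMeasure μ] {N : α → ℕ} (hN : Measurable N) {a b : ℝ}
    (h : HasExpansion (fun x => ∫ ω, (1 - x) ^ N ω ∂μ) 1 (-a) b) :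
    (Integrable (fun ω => (N ω : ℝ)) μ ∧ ∫ ω, (N ω : ℝ) ∂μ = a) ∧
    (Integrable (fun ω => (N ω : ℝ) * (N ω - 1) / 2) μ ∧
      ∫ ω, (N ω : ℝ) * (N ω - 1) / 2 ∂μ = b) := by
  have hpow : ∀ n, Integrable (fun ω => nearOne n ^ N ω) μ := fun n =>
    integrable_pow_nat hN (nearOne_nonneg n) (nearOne_lt_one n).le
  have g1 : ∀ n ω, geom1 (nearOne n) (N ω) = (1 - nearOne n ^ N ω) * (n + 1) := fun n ω => by
    have := one_sub_mul_geom1 (nearOne n) (N ω)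
    rw [one_sub_nearOne] at this
    rw [← this]; field_simp
  have i1 : ∀ n, Integrable (fun ω => geom1 (nearOne n) (N ω)) μ := fun n => by
    simp only [g1]
    exact ((integrable_const _).sub (hpow n)).mul_const _
  have e1 : ∀ n, ∫ ω, geom1 (nearOne n) (N ω) ∂μ
      = (1 - ∫ ω, (1 - 1 / ((n : ℝ) + 1)) ^ N ω ∂μ) * (n + 1) := fun n => by
    simp only [g1]
    rw [integral_mul_const, integral_sub (integrable_const _) (hpow n)]
    simp [nearOne]
  have A := integrable_of_monotone_tendsto (F := fun ω => (N ω : ℝ)) (A := a) i1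
    (fun n ω => geom1_nonneg (nearOne_nonneg n) _)
    (fun ω m n hmn => geom1_mono (nearOne_nonneg m) (nearOne_mono hmn) _)
    (fun ω => by simpa [geom1_one] using tendsto_geom1 tendsto_nearOne (N ω)) (by
      simp only [e1]
      have h1 := ((HasExpansion.quadratic 1 0 0).sub h).congr_right (sub_self 1) (b' := a)
        (by ring) rfl
      refine (h1.tendsto_first.comp tendsto_inv_nat).congr fun n => ?_
      simp)
  refine ⟨A, ?_⟩
  have g2 : ∀ n ω, geom2 (nearOne n) (N ω) = (N ω - geom1 (nearOne n) (N ω)) * (n + 1) :=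
    fun n ω => by
    have := one_sub_mul_geom2 (nearOne n) (N ω)
    rw [one_sub_nearOne] at this
    rw [← this]; field_simp
  have i2 : ∀ n, Integrable (fun ω => geom2 (nearOne n) (N ω)) μ := fun n => by
    simp only [g2]
    exact (A.1.sub (i1 n)).mul_const _
  have e2 : ∀ n, ∫ ω, geom2 (nearOne n) (N ω) ∂μ
      = (a - (1 - ∫ ω, (1 - 1 / ((n : ℝ) + 1)) ^ N ω ∂μ) * (n + 1)) * (n + 1) := fun n => by
    simp only [g2]
    rw [integral_mul_const, integral_sub A.1 (i1 n), A.2, e1]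
  refine integrable_of_monotone_tendsto i2
    (fun n ω => Finset.sum_nonneg fun i _ => geom1_nonneg (nearOne_nonneg n) _)
    (fun ω m n hmn => Finset.sum_le_sum fun i _ =>
      geom1_mono (nearOne_nonneg m) (nearOne_mono hmn) _)
    (fun ω => by
      rw [← geom2_one]
      exact tendsto_finsetSum _ fun i _ => tendsto_geom1 tendsto_nearOne i) ?_
  simp only [e2]
  have h1 := (h.sub (HasExpansion.quadratic 1 (-a) 0)).congr_right (sub_self 1) (sub_self (-a))
    (c' := b) (by ring)
  refine (h1.tendsto_second.comp tendsto_inv_nat).congr fun n => ?_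
  have : (n : ℝ) + 1 ≠ 0 := by positivity
  simp only [Function.comp_def]
  field_simp
  ring

lemma HasExpansion.comp_div {φ : ℝ → ℝ} {a b c : ℝ} (h : HasExpansion φ a b c) :
    HasExpansion (fun x => φ (x / (1 + x))) a b (c - b) := by
  have ht : Tendsto (fun x : ℝ => x / (1 + x)) (𝓝[>] 0) (𝓝[>] 0) := by
    refine tendsto_nhdsWithin_iff.2 ⟨?_, ?_⟩
    · have : ContinuousAt (fun x : ℝ => x / (1 + x)) 0 :=
        ContinuousAt.div (by fun_prop) (by fun_prop) (by norm_num)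
      simpa using tendsto_nhdsWithin_of_tendsto_nhds this.tendsto
    · filter_upwards [self_mem_nhdsWithin] with x hx
      have : (0 : ℝ) < x := hx
      simp only [Set.mem_Ioi]; positivity
  have h1 : HasExpansion (fun x => x / (1 + x)) 0 1 (-1) := by
    refine (((HasExpansion.quadratic 0 1 0).mul HasExpansion.inv_one_add).congr_right
      (by ring) (by ring) (by ring)).congr_left fun x _ => ?_
    ring
  have h2 := (((HasExpansion.quadratic a 0 0).add (h1.const_mul b)).add
    ((h1.mul h1).const_mul c))
  have h3 := (IsBigO.comp_tendsto h ht)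
  have h4 : ((fun x : ℝ => x ^ 3) ∘ fun x => x / (1 + x)) =O[𝓝[>] 0] fun x => x ^ 3 := by
    refine IsBigO.of_bound 1 ?_
    filter_upwards [self_mem_nhdsWithin] with x hx
    have : (0 : ℝ) < x := hx
    simp only [Function.comp_def, norm_pow, one_mul]
    gcongr
    rw [Real.norm_of_nonneg (by positivity), Real.norm_of_nonneg this.le]
    rw [div_le_iff₀ (by positivity)]
    nlinarith
  have h5 : HasExpansion (fun x => φ (x / (1 + x)) - (a + b * (x / (1 + x))
      + c * (x / (1 + x)) ^ 2)) 0 0 0 := by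
    refine (h3.trans h4).congr_left fun x => ?_
    simp only [Function.comp_def]; ring
  refine ((h5.add h2).congr_right (by ring) (by ring) (by ring)).congr_left fun x _ => ?_
  ring

/-- The mean of `backlog k`. -/
def backlogMean (q : ℕ → ℝ) (k : ℕ) : ℝ := ∫ τ, (backlog k τ : ℝ) ∂stacksLaw q

/-- The second binomial moment of `backlog k`. -/
def backlogBinom2 (q : ℕ → ℝ) (k : ℕ) : ℝ :=
  ∫ τ, (backlog k τ : ℝ) * (backlog k τ - 1) / 2 ∂stacksLaw q

section

variable {M : ℕ} {q : ℕ → ℝ}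

lemma hasExpansion_backlogGen_succ (h : IsStrength M q) (k : ℕ) {a b : ℝ}
    (hk : HasExpansion (fun x => backlogGen q k (1 - x)) 1 (-a) b) :
    HasExpansion (fun x => backlogGen q (k + 1) (1 - x)) 1
      (-(a + fullMean M q 1 + ∑ j ∈ Finset.range M, backlogCdf q k j * gap M q j))
      (b + a + fullMean M q 1 * a + fullBinom2 M q 1
        + ∑ j ∈ Finset.range M, backlogCdf q k j * gap2 M q j) := by
  have h1 := ((hasExpansion_fullGenFun M q 1).mul hk.comp_div).add
    (HasExpansion.sum (s := Finset.range M) fun j _ =>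
      (hasExpansion_excessDiff M q j).const_mul (backlogCdf q k j))
  have h2 := h1.congr_right (a' := 1)
    (b' := -(a + fullMean M q 1 + ∑ j ∈ Finset.range M, backlogCdf q k j * gap M q j))
    (c' := b + a + fullMean M q 1 * a + fullBinom2 M q 1
        + ∑ j ∈ Finset.range M, backlogCdf q k j * gap2 M q j)
    (by simp) (by simp [Finset.sum_neg_distrib]; ring) (by ring)
  refine IsBigO.congr' h2 ?_ EventuallyEq.rfl
  filter_upwards [Ioo_mem_nhdsGT (zero_lt_one (α := ℝ))] with x hx
  rw [backlogGen_succ h k hx.1.le hx.2.le]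
  have : 1 - x / (1 + x) = 1 / (1 + x) := by
    have : 1 + x ≠ 0 := by linarith [hx.1]
    field_simp; ring
  rw [this]

lemma hasExpansion_backlogGen (h : IsStrength M q) (k : ℕ) :
    HasExpansion (fun x => backlogGen q k (1 - x)) 1 (-backlogMean q k) (backlogBinom2 q k) := by
  suffices h1 : ∃ a b, HasExpansion (fun x => backlogGen q k (1 - x)) 1 (-a) b by
    obtain ⟨a, b, hab⟩ := h1
    obtain ⟨⟨_, h2⟩, _, h3⟩ := moments_of_hasExpansion (measurable_backlog k) hab
    rw [backlogMean, backlogBinom2, h2, h3]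
    exact hab
  induction k with
  | zero => exact ⟨0, 0, by simpa [backlogGen, backlog] using HasExpansion.quadratic 1 0 0⟩
  | succ k ih =>
    obtain ⟨a, b, hab⟩ := ih
    exact ⟨_, _, hasExpansion_backlogGen_succ h k hab⟩

lemma integrable_backlog (h : IsStrength M q) (k : ℕ) :
    Integrable (fun τ => (backlog k τ : ℝ)) (stacksLaw q) :=
  (moments_of_hasExpansion (measurable_backlog k) (hasExpansion_backlogGen h k)).1.1

lemma integrable_backlog_binom2 (h : IsStrength M q) (k : ℕ) :
    Integrable (fun τ => (backlog k τ : ℝ) * (backlog k τ - 1) / 2) (stacksLaw q) :=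
  (moments_of_hasExpansion (measurable_backlog k) (hasExpansion_backlogGen h k)).2.1

lemma backlogMean_succ (h : IsStrength M q) (k : ℕ) :
    backlogMean q (k + 1) = backlogMean q k + fullMean M q 1
      + ∑ j ∈ Finset.range M, backlogCdf q k j * gap M q j :=
  (moments_of_hasExpansion (measurable_backlog _)
    (hasExpansion_backlogGen_succ h k (hasExpansion_backlogGen h k))).1.2

lemma backlogBinom2_succ (h : IsStrength M q) (k : ℕ) :
    backlogBinom2 q (k + 1) = backlogBinom2 q k + backlogMean q k
      + fullMean M q 1 * backlogMean q k + fullBinom2 M q 1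
      + ∑ j ∈ Finset.range M, backlogCdf q k j * gap2 M q j :=
  (moments_of_hasExpansion (measurable_backlog _)
    (hasExpansion_backlogGen_succ h k (hasExpansion_backlogGen h k))).2.2

@[simp] lemma backlogMean_zero (q : ℕ → ℝ) : backlogMean q 0 = 0 := by
  simp [backlogMean, backlog]

@[simp] lemma backlogBinom2_zero (q : ℕ → ℝ) : backlogBinom2 q 0 = 0 := by
  simp [backlogBinom2, backlog]

lemma backlogMean_nonneg (q : ℕ → ℝ) (k : ℕ) : 0 ≤ backlogMean q k :=
  integral_nonneg fun _ => Nat.cast_nonneg _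

lemma backlogMean_mono (h : IsStrength M q) : Monotone (backlogMean q) := by
  intro k l hkl
  refine integral_mono_ae (integrable_backlog h k) (integrable_backlog h l) ?_
  filter_upwards [ae_monotone_backlog h] with τ hτ
  exact_mod_cast hτ hkl

lemma nat_mul_pred_mono {a b : ℕ} (hab : a ≤ b) :
    (a : ℝ) * (a - 1) / 2 ≤ (b : ℝ) * (b - 1) / 2 := by
  rw [← geom2_one, ← geom2_one]
  exact Finset.sum_le_sum_of_subset_of_nonneg (Finset.range_mono hab)
    fun i _ _ => geom1_nonneg zero_le_one i

lemma backlogBinom2_mono (h : IsStrength M q) : Monotone (backlogBinom2 q) := by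
  intro k l hkl
  refine integral_mono_ae (integrable_backlog_binom2 h k) (integrable_backlog_binom2 h l) ?_
  filter_upwards [ae_monotone_backlog h] with τ hτ
  exact nat_mul_pred_mono (hτ hkl)

lemma backlogMean_sq_le (h : IsStrength M q) (k : ℕ) :
    backlogMean q k ^ 2 ≤ 2 * backlogBinom2 q k + backlogMean q k := by
  set m := backlogMean q k with hm
  have i1 := integrable_backlog h k
  have i2 := integrable_backlog_binom2 h k
  have h0 : 0 ≤ ∫ τ, 2 * ((backlog k τ : ℝ) * (backlog k τ - 1) / 2)
      + ((1 - 2 * m) * (backlog k τ : ℝ) + m ^ 2) ∂stacksLaw q :=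
    integral_nonneg fun τ => by
      have := sq_nonneg ((backlog k τ : ℝ) - m)
      simp only [Pi.zero_apply]
      linarith
  have i3 : Integrable (fun τ => (1 - 2 * m) * (backlog k τ : ℝ) + m ^ 2) (stacksLaw q) :=
    (i1.const_mul _).add (integrable_const _)
  rw [integral_add (i2.const_mul 2) i3, integral_add (i1.const_mul _) (integrable_const _), integral_const_mul,
    integral_const_mul] at h0
  simp only [integral_const, probReal_univ, one_smul] at h0
  change 0 ≤ 2 * backlogBinom2 q k + ((1 - 2 * m) * backlogMean q k + m ^ 2) at h0
  rw [← hm] at h0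
  linarith

end

section

variable {M : ℕ} {q : ℕ → ℝ}

lemma measureReal_backlog_eq_zero (q : ℕ → ℝ) (k : ℕ) : backlogGen q k 0 = backlogCdf q k 0 := by
  have := integral_indicator_const (μ := stacksLaw q) (1 : ℝ) (measurableSet_backlog_le k 0)
  rw [backlogCdf, ← mul_one ((stacksLaw q).real _), ← smul_eq_mul, ← this, backlogGen]
  congr 1
  ext τ
  by_cases h : backlog k τ = 0 <;> simp [h]

lemma exists_le_backlogCdf_zero (h : IsStrength M q) {B : ℝ} (hB : ∀ k, backlogMean q k ≤ B) :
    ∃ c > 0, ∀ k, c ≤ backlogCdf q k 0 := by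
  obtain ⟨K, hK⟩ := exists_nat_gt (max (2 * B) 0)
  have hK0 : (0 : ℝ) < K := (le_max_right _ _).trans_lt hK
  have hKB : 2 * B < K := (le_max_left _ _).trans_lt hK
  have hkey : ∀ z : ℕ, (1 / 2 : ℝ) ^ (K + 1) * (1 - z / K) ≤ (1 / 2) ^ (z + 1) := by
    intro z
    rcases le_total z K with hz | hz
    · calc (1 / 2 : ℝ) ^ (K + 1) * (1 - z / K) ≤ (1 / 2 : ℝ) ^ (K + 1) * 1 := by
            gcongr; linarith [show (0 : ℝ) ≤ z / K by positivity]
        _ ≤ (1 / 2) ^ (z + 1) := by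
            rw [mul_one]
            exact pow_le_pow_of_le_one (by norm_num) (by norm_num) (by omega)
    · have h1 : (1 : ℝ) ≤ z / K := by
        rw [le_div_iff₀ hK0, one_mul]; exact_mod_cast hz
      have : (1 / 2 : ℝ) ^ (K + 1) * (1 - z / K) ≤ 0 :=
        mul_nonpos_of_nonneg_of_nonpos (by positivity) (by linarith)
      exact this.trans (by positivity)
  refine ⟨(1 / 2) ^ (K + 2), by positivity, fun k => ?_⟩
  cases k with
  | zero =>
    have : backlogCdf q 0 0 = 1 := by simp [backlogCdf, backlog]
    rw [this]
    exact pow_le_one₀ (by norm_num) (by norm_num)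
  | succ k =>
    obtain ⟨i1, e1⟩ := backlogGen_succ_eq_integral h k (s := 0) le_rfl zero_le_one
    rw [← measureReal_backlog_eq_zero, e1]
    have i2 : Integrable (fun τ => (1 / 2 : ℝ) ^ (K + 1) * (1 - backlog k τ / K)) (stacksLaw q) :=
      ((integrable_const _).sub ((integrable_backlog h k).div_const _)).const_mul _
    have e2 : ∫ τ, (1 / 2 : ℝ) ^ (K + 1) * (1 - backlog k τ / K) ∂stacksLaw q
        = (1 / 2) ^ (K + 1) * (1 - backlogMean q k / K) := by
      rw [integral_const_mul, integral_sub (integrable_const _)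
        ((integrable_backlog h k).div_const _), integral_div]
      simp [backlogMean]
    calc (1 / 2 : ℝ) ^ (K + 2) = (1 / 2) ^ (K + 1) * (1 / 2) := by rw [pow_succ]
      _ ≤ (1 / 2) ^ (K + 1) * (1 - backlogMean q k / K) := by
          gcongr
          have : backlogMean q k / K ≤ 1 / 2 := by
            rw [div_le_iff₀ hK0]; linarith [hB k]
          linarith
      _ ≤ _ := by
          rw [← e2]
          exact integral_mono i2 i1 fun τ => (hkey _).trans
            (half_pow_le_genFun h _ le_rfl zero_le_one)

lemma fullMean_add_one (M : ℕ) (q : ℕ → ℝ) (z : ℕ) :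
    fullMean M q (z + 1) = z + fullMean M q 1 := by
  induction z with
  | zero => simp
  | succ z ih => rw [fullMean_succ, ih]; push_cast; ring

lemma fullBinom2_succ (M : ℕ) (q : ℕ → ℝ) (r : ℕ) :
    fullBinom2 M q (r + 1) = fullBinom2 M q r + fullMean M q r + 1 := by
  induction M generalizing q with
  | zero => simp only [fullBinom2, fullMean]; push_cast; ring
  | succ M ih => simp only [fullBinom2, fullMean, ih, fullMean_succ]; ring

lemma fullBinom2_add_one (hα : fullMean M q 1 = -1) (z : ℕ) :
    fullBinom2 M q (z + 1) = fullBinom2 M q 1 + z * (z - 1) / 2 := by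
  induction z with
  | zero => simp
  | succ z ih => rw [fullBinom2_succ, ih, fullMean_add_one, hα]; push_cast; ring

lemma fullBinom2_bound (h : IsStrength M q) (r : ℕ) :
    fullMean M q r ^ 2 + fullMean M q r ≤ 2 * fullBinom2 M q r := by
  induction M generalizing q with
  | zero => simp only [fullBinom2, fullMean]; exact le_of_eq (by ring)
  | succ M ih =>
    have := ih h.tail
    have a0 := h.half_le 0
    have b0 := (h.lt_one 0).le
    simp only [fullBinom2, fullMean]
    nlinarith

lemma fullBinom2_nonneg (h : IsStrength M q) (hα : fullMean M q 1 = -1) :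
    0 ≤ fullBinom2 M q 1 := by
  have := fullBinom2_bound h 1
  rw [hα] at this
  linarith

lemma hasExpansion_integral_failures (h : IsStrength M q) (r : ℕ) :
    HasExpansion (fun x => ∫ σ, (1 - x) ^ failures σ r ∂stackLaw q) 1 (-mean M q r)
      (binom2 M q r) := by
  refine IsBigO.congr' (hasExpansion_genFun M q r) ?_ EventuallyEq.rfl
  filter_upwards [Ioo_mem_nhdsGT (zero_lt_one (α := ℝ))] with x hx
  rw [integral_pow_failures h (by linarith [hx.2]) (by linarith [hx.1])]

lemma mean_binom2_eq_full (h : IsStrength M q) {r : ℕ} (hr : M ≤ r) :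
    mean M q r = fullMean M q r ∧ binom2 M q r = fullBinom2 M q r := by
  have : HasExpansion (fun _ => 0) (1 - 1) (-mean M q r - -fullMean M q r)
      (binom2 M q r - fullBinom2 M q r) := by
    refine ((hasExpansion_genFun M q r).sub (hasExpansion_fullGenFun M q r)).congr_left
      fun x hx => ?_
    rw [genFun_eq_fullGenFun (fun i hi _ => h.fair i (hr.trans hi)) hx.le, sub_self]
  obtain ⟨_, h1, h2⟩ := this.eq_zero
  constructor <;> linarith

/-- At criticality the backlog chain dominates a strict submartingale, so its second moments
are unbounded. -/
lemma not_bounded_moments (hM : 1 ≤ M) (h : IsStrength M q) (hα : fullMean M q 1 = -1) {B : ℝ}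
    (hB1 : ∀ k, backlogMean q k ≤ B) (hB2 : ∀ k, backlogBinom2 q k ≤ B) : False := by
  obtain ⟨c₀, hc₀, hcdf⟩ := exists_le_backlogCdf_zero h hB1
  set c := fullBinom2 M q 1 with hc
  have hc0 : 0 ≤ c := fullBinom2_nonneg h hα
  let g : ℕ → ℝ := fun n => (n : ℝ) * (n - 1) / 2 + c * n
  have hgmono : Monotone g := fun a b hab => by
    have h1 := nat_mul_pred_mono hab
    have h2 : (a : ℝ) ≤ b := by exact_mod_cast hab
    have := mul_le_mul_of_nonneg_left h2 hc0
    simp only [g]; linarith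
  have hg0 : ∀ n, 0 ≤ g n := fun n => by simpa [g] using hgmono (Nat.zero_le n)
  set K := g M with hK
  have hgM : K + 1 ≤ g (M + 1) := by
    have : (1 : ℝ) ≤ M := by exact_mod_cast hM
    simp only [hK, g]; push_cast; nlinarith
  let φ : ℕ → ℝ := fun n => max (g n) K
  have hint : ∀ {α : Type} [MeasurableSpace α] {μ : Measure α} [IsProbabilityMeasure μ]
      {N : α → ℕ} {a b : ℝ}, Measurable N →
      HasExpansion (fun x => ∫ ω, (1 - x) ^ N ω ∂μ) 1 (-a) b →
      Integrable (fun ω => φ (N ω)) μ ∧ Integrable (fun ω => g (N ω)) μ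
        ∧ ∫ ω, g (N ω) ∂μ = b + c * a := by
    intro α _ μ _ N a b hN hexp
    obtain ⟨⟨i1, e1⟩, i2, e2⟩ := moments_of_hasExpansion hN hexp
    have i3 : Integrable (fun ω => g (N ω)) μ := i2.add (i1.const_mul c)
    refine ⟨i3.sup (integrable_const K), i3, ?_⟩
    simp only [g]
    rw [integral_add i2 (i1.const_mul c), integral_const_mul, e1, e2]
  obtain ⟨ε, hε, hε0⟩ : ∃ ε > 0, φ 0 + ε ≤ ∫ σ, φ (failures σ 1) ∂stackLaw q := by
    have hms : MeasurableSet {σ : ℕ → Bool | M + 1 ≤ failures σ 1} :=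
      measurableSet_le measurable_const (measurable_failures 1)
    refine ⟨(stackLaw q).real {σ | M + 1 ≤ failures σ 1}, ?_, ?_⟩
    · refine ENNReal.toReal_pos ?_ (measure_ne_top _ _)
      refine ((stackLaw_all_false h (M + 1)).trans_le (measure_mono_ae ?_)).ne'
      filter_upwards [ae_good h] with σ hσ hf
      exact le_failures_of_all_false hσ hf
    · have e1 := integral_indicator_const (μ := stackLaw q) (1 : ℝ) hms
      rw [smul_eq_mul, mul_one] at e1
      have hφ0 : φ 0 = K := max_eq_right (hgmono (Nat.zero_le M))
      have i1 : Integrable ({σ : ℕ → Bool | M + 1 ≤ failures σ 1}.indicator fun _ => (1 : ℝ))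
        (stackLaw q) := (integrable_const 1).indicator hms
      have : ∫ σ, (K + {σ : ℕ → Bool | M + 1 ≤ failures σ 1}.indicator (fun _ => (1 : ℝ)) σ)
          ∂stackLaw q = K + (stackLaw q).real {σ | M + 1 ≤ failures σ 1} := by
        rw [integral_add (integrable_const K) i1, e1]; simp
      rw [hφ0, ← this]
      refine integral_mono ((integrable_const K).add i1) (hint (measurable_failures 1)
        (hasExpansion_integral_failures h 1)).1 fun σ => ?_
      by_cases hσ : M + 1 ≤ failures σ 1
      · have h2 : g (M + 1) ≤ g (failures σ 1) := hgmono hσ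
        simp only [Set.indicator_apply, Set.mem_ofPred_eq, if_pos hσ]
        exact le_max_of_le_left (by linarith)
      · simp only [Set.indicator_apply, Set.mem_ofPred_eq, if_neg hσ, add_zero]
        exact le_max_right _ _
  have hstep : ∀ z, φ z + (if z ≤ 0 then ε else 0)
      ≤ ∫ σ, φ (failures σ (z + 1)) ∂stackLaw q := by
    intro z
    obtain ⟨i1, i2, e2⟩ := hint (measurable_failures (z + 1))
      (hasExpansion_integral_failures h (z + 1))
    rcases Nat.eq_zero_or_pos z with rfl | hz
    · simpa using hε0
    rw [if_neg (by omega), add_zero]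
    refine max_le ?_ ?_
    · rcases le_total z M with hzM | hzM
      · refine (hgmono hzM).trans ?_
        simpa using integral_mono (μ := stackLaw q) (integrable_const K) i1
          fun σ => le_max_right _ _
      · obtain ⟨m1, m2⟩ := mean_binom2_eq_full h (r := z + 1) (by omega)
        have : g z = ∫ σ, g (failures σ (z + 1)) ∂stackLaw q := by
          rw [e2, m1, m2, fullBinom2_add_one hα, fullMean_add_one, hα]
          simp only [g, hc]; ring
        rw [this]
        exact integral_mono i2 i1 fun σ => le_max_left _ _
    · simpa using integral_mono (μ := stackLaw q) (integrable_const K) i1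
          fun σ => le_max_right _ _
  have hI : ∀ k, Integrable (fun τ => φ (backlog k τ)) (stacksLaw q) ∧
      Integrable (fun τ => g (backlog k τ)) (stacksLaw q) ∧
      ∫ τ, g (backlog k τ) ∂stacksLaw q = backlogBinom2 q k + c * backlogMean q k := fun k =>
    hint (measurable_backlog k) (hasExpansion_backlogGen h k)
  have hgrow : ∀ k, ∫ τ, φ (backlog k τ) ∂stacksLaw q + ε * c₀
      ≤ ∫ τ, φ (backlog (k + 1) τ) ∂stacksLaw q := by
    intro k
    obtain ⟨i1, e1⟩ := integral_backlog_succ q k (hI (k + 1)).1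
    have i2 : Integrable (fun τ => if backlog k τ ≤ 0 then ε else 0) (stacksLaw q) := by
      refine ((integrable_const ε).indicator (measurableSet_backlog_le k 0)).congr
        (ae_of_all _ fun τ => ?_)
      simp only [Set.indicator_apply, Set.mem_ofPred_eq]
    have e2 : ∫ τ, (if backlog k τ ≤ 0 then ε else 0) ∂stacksLaw q = backlogCdf q k 0 * ε := by
      have := integral_indicator_const (μ := stacksLaw q) ε (measurableSet_backlog_le k 0)
      rw [backlogCdf, ← smul_eq_mul, ← this]
      simp only [Set.indicator_apply, Set.mem_ofPred_eq]
    have := integral_mono ((hI k).1.add i2) i1 fun τ => hstep (backlog k τ)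
    rw [e1]
    refine le_trans ?_ this
    have e3 : ∫ τ, ((fun τ => φ (backlog k τ)) + fun τ => if backlog k τ ≤ 0 then ε else 0) τ
        ∂stacksLaw q = ∫ τ, φ (backlog k τ) ∂stacksLaw q + backlogCdf q k 0 * ε := by
      rw [← e2]; exact integral_add (hI k).1 i2
    rw [e3, mul_comm ε]
    gcongr
    exact hcdf k
  have hlow : ∀ k : ℕ, k * (ε * c₀) ≤ ∫ τ, φ (backlog k τ) ∂stacksLaw q := by
    intro k
    induction k with
    | zero =>
      simp only [Nat.cast_zero, zero_mul]
      exact integral_nonneg fun τ => le_max_of_le_left (hg0 _)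
    | succ k ih => push_cast; linarith [hgrow k]
  have hup : ∀ k, ∫ τ, φ (backlog k τ) ∂stacksLaw q ≤ K + (B + c * B) := by
    intro k
    have : ∫ τ, φ (backlog k τ) ∂stacksLaw q ≤ ∫ τ, (K + g (backlog k τ)) ∂stacksLaw q :=
      integral_mono (hI k).1 ((integrable_const K).add (hI k).2.1) fun τ =>
        max_le (by linarith [hg0 M]) (by linarith [hg0 (backlog k τ)])
    rw [integral_add (integrable_const K) (hI k).2.1, (hI k).2.2] at this
    simp only [integral_const, probReal_univ, one_smul] at this
    linarith [hB2 k, mul_le_mul_of_nonneg_left (hB1 k) hc0]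
  obtain ⟨n, hn⟩ := exists_nat_gt ((K + (B + c * B)) / (ε * c₀))
  rw [div_lt_iff₀ (by positivity)] at hn
  linarith [hlow n, hup n]

end

/-- The limiting drift increment of the backlog chain. -/
def limitGap (M : ℕ) (q : ℕ → ℝ) : ℝ := ∑ j ∈ Finset.range M, limitCdf q j * gap M q j

/-- The limiting increment of the second binomial moment of the backlog chain
at criticality. -/
def limitBinom2 (M : ℕ) (q : ℕ → ℝ) : ℝ :=
  fullBinom2 M q 1 + ∑ j ∈ Finset.range M, limitCdf q j * gap2 M q j

section

variable {M : ℕ} {q : ℕ → ℝ}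

lemma tendsto_sum_cdf_mul (h : IsStrength M q) (f : ℕ → ℝ) :
    Tendsto (fun k => ∑ j ∈ Finset.range M, backlogCdf q k j * f j) atTop
      (𝓝 (∑ j ∈ Finset.range M, limitCdf q j * f j)) :=
  tendsto_finsetSum _ fun j _ => (tendsto_backlogCdf h j).mul_const _

lemma sum_cdf_mul_le (q f : ℕ → ℝ) (k : ℕ) :
    ∑ j ∈ Finset.range M, backlogCdf q k j * f j ≤ ∑ j ∈ Finset.range M, |f j| :=
  Finset.sum_le_sum fun j _ => by
    calc backlogCdf q k j * f j ≤ |backlogCdf q k j * f j| := le_abs_self _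
      _ = backlogCdf q k j * |f j| := by rw [abs_mul, abs_of_nonneg (backlogCdf_nonneg q k j)]
      _ ≤ 1 * |f j| := by gcongr; exact backlogCdf_le_one q k j
      _ = |f j| := one_mul _

lemma limitGap_eq_of_bounded (h : IsStrength M q) {B : ℝ} (hB : ∀ k, backlogMean q k ≤ B) :
    limitGap M q = -fullMean M q 1 := by
  have h1 : Tendsto (backlogMean q) atTop (𝓝 (⨆ k, backlogMean q k)) :=
    tendsto_atTop_ciSup (backlogMean_mono h) ⟨B, by rintro _ ⟨k, rfl⟩; exact hB k⟩
  have h2 := (h1.comp (tendsto_add_atTop_nat 1)).sub h1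
  have h3 := tendsto_nhds_unique h2 (((tendsto_sum_cdf_mul h (gap M q)).const_add
    (fullMean M q 1)).congr fun k => by
      simp only [Function.comp_def, backlogMean_succ h]; ring)
  rw [limitGap]; linarith

lemma backlogMean_bounded (h : IsStrength M q) (hα : fullMean M q 1 < -1) :
    ∃ B, ∀ k, backlogMean q k ≤ B := by
  refine ⟨(fullBinom2 M q 1 + ∑ j ∈ Finset.range M, |gap2 M q j|) / (-1 - fullMean M q 1),
    fun k => ?_⟩
  rw [le_div_iff₀ (by linarith)]
  have h1 := backlogBinom2_mono h (Nat.le_add_right k 1)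
  rw [backlogBinom2_succ h] at h1
  have h2 := sum_cdf_mul_le (M := M) q (gap2 M q) k
  linarith

lemma limitGap_eq (h : IsStrength M q) (hα : fullMean M q 1 ≤ -1) :
    limitGap M q = -fullMean M q 1 := by
  rcases hα.lt_or_eq with hα | hα
  · obtain ⟨B, hB⟩ := backlogMean_bounded h hα
    exact limitGap_eq_of_bounded h hB
  have hcdf : ∀ k, limitGap M q ≤ ∑ j ∈ Finset.range M, backlogCdf q k j * gap M q j := fun k =>
    Finset.sum_le_sum fun j _ => mul_le_mul_of_nonneg_right (limitCdf_le q k j) (gap_nonneg h j)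
  refine le_antisymm ?_ ?_
  · by_contra! hlt
    rw [hα] at hlt
    set η := limitGap M q - 1 with hη
    have hη0 : 0 < η := by linarith
    set G := ∑ j ∈ Finset.range M, |gap M q j| with hG
    set D := fullBinom2 M q 1 + ∑ j ∈ Finset.range M, |gap2 M q j| with hD
    have h1 : ∀ k : ℕ, k * η ≤ backlogMean q k := fun k => by
      induction k with
      | zero => simp
      | succ k ih => rw [backlogMean_succ h, hα]; push_cast; linarith [hcdf k]
    have h2 : ∀ k : ℕ, backlogMean q k ≤ k * (G - 1) := fun k => by
      induction k with
      | zero => simp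
      | succ k ih =>
        rw [backlogMean_succ h, hα]; push_cast
        linarith [sum_cdf_mul_le (M := M) q (gap M q) k]
    have h3 : ∀ k : ℕ, backlogBinom2 q k ≤ k * D := fun k => by
      induction k with
      | zero => simp
      | succ k ih =>
        rw [backlogBinom2_succ h, hα]; push_cast
        linarith [sum_cdf_mul_le (M := M) q (gap2 M q) k]
    obtain ⟨n, hn⟩ := exists_nat_gt ((2 * D + (G - 1)) / η ^ 2)
    rw [div_lt_iff₀ (by positivity)] at hn
    have h4 : ((n + 1 : ℕ) * η) ^ 2 ≤ 2 * ((n + 1 : ℕ) * D) + (n + 1 : ℕ) * (G - 1) := by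
      refine (pow_le_pow_left₀ (by positivity) (h1 (n + 1)) 2).trans ?_
      linarith [backlogMean_sq_le h (n + 1), h2 (n + 1), h3 (n + 1)]
    push_cast at h4
    have h5 : (n + 1 : ℝ) * ((n + 1) * η ^ 2) ≤ (n + 1) * (2 * D + (G - 1)) := by linarith
    have h6 := le_of_mul_le_mul_left h5 (by positivity)
    nlinarith [sq_nonneg η]
  · refine ge_of_tendsto' (tendsto_sum_cdf_mul h (gap M q)) fun k => ?_
    have := backlogMean_mono h (Nat.le_add_right k 1)
    rw [backlogMean_succ h] at this
    linarith

lemma limitBinom2_pos (hM : 1 ≤ M) (h : IsStrength M q) (hα : fullMean M q 1 = -1) :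
    0 < limitBinom2 M q := by
  have hstep : ∀ k, backlogBinom2 q (k + 1) = backlogBinom2 q k + (fullBinom2 M q 1
      + ∑ j ∈ Finset.range M, backlogCdf q k j * gap2 M q j) := fun k => by
    rw [backlogBinom2_succ h, hα]; ring
  have h0 : 0 ≤ limitBinom2 M q := by
    refine ge_of_tendsto' ((tendsto_sum_cdf_mul h (gap2 M q)).const_add _) fun k => ?_
    have := backlogBinom2_mono h (Nat.le_add_right k 1)
    rw [hstep] at this
    linarith
  refine h0.lt_of_ne fun hb => ?_
  set C := ∑ j ∈ Finset.range M, |gap2 M q j| / gap M q j with hC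
  have hnn : ∀ j, 0 ≤ |gap2 M q j| / gap M q j := fun j =>
    div_nonneg (abs_nonneg _) (gap_nonneg h j)
  have hC0 : 0 ≤ C := Finset.sum_nonneg fun j _ => hnn j
  have hCj : ∀ j ∈ Finset.range M, gap2 M q j ≤ C * gap M q j := fun j hj => by
    rcases (gap_nonneg h j).eq_or_lt with hg | hg
    · rw [← hg, gap2_eq_zero h hg.symm, mul_zero]
    · refine (le_abs_self _).trans ?_
      rw [← div_le_iff₀ hg]
      exact Finset.single_le_sum (f := fun j => |gap2 M q j| / gap M q j) (fun j _ => hnn j) hj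
  have hgap := limitGap_eq h hα.le
  have hs : ∀ k, backlogBinom2 q k ≤ C * backlogMean q k := fun k => by
    induction k with
    | zero => simp
    | succ k ih =>
      have h1 : (∑ j ∈ Finset.range M, backlogCdf q k j * gap2 M q j)
          - ∑ j ∈ Finset.range M, limitCdf q j * gap2 M q j
          ≤ C * ((∑ j ∈ Finset.range M, backlogCdf q k j * gap M q j)
          - ∑ j ∈ Finset.range M, limitCdf q j * gap M q j) := by
        rw [← Finset.sum_sub_distrib, ← Finset.sum_sub_distrib, Finset.mul_sum]
        refine Finset.sum_le_sum fun j hj => ?_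
        have := mul_le_mul_of_nonneg_left (hCj j hj) (sub_nonneg.2 (limitCdf_le q k j))
        linarith
      rw [← limitGap, hgap, hα] at h1
      rw [hstep, backlogMean_succ h, hα]
      rw [limitBinom2] at hb
      linarith
  have hm : ∀ k, backlogMean q k ≤ 2 * C + 1 := fun k => by
    have h1 := backlogMean_sq_le h k
    have h2 := hs k
    rcases (backlogMean_nonneg q k).eq_or_lt with hz | hz
    · rw [← hz]; linarith
    · refine le_of_mul_le_mul_left ?_ hz
      nlinarith
  refine not_bounded_moments hM h hα (B := 2 * C + 1 + C * (2 * C + 1)) (fun k => ?_) fun k => ?_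
  · have : 0 ≤ C * (2 * C + 1) := by positivity
    linarith [hm k]
  · have := mul_le_mul_of_nonneg_left (hm k) hC0
    linarith [hs k]

lemma le_zero_of_tendsto_mul_diff {y : ℕ → ℝ} {B z : ℝ} (hy : Monotone y) (hB : ∀ n, y n ≤ B)
    (hz : Tendsto (fun n : ℕ => (y (n + 1) - y n) * (n + 1)) atTop (𝓝 z)) : z ≤ 0 := by
  by_contra! hpos
  have h1 : Summable fun n => y (n + 1) - y n := by
    refine summable_of_sum_range_le (c := B - y 0)
      (fun n => sub_nonneg.2 (hy (Nat.le_succ n))) fun n => ?_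
    rw [Finset.sum_range_sub]
    linarith [hB n]
  have h2 : (fun n : ℕ => 1 / ((n + 1 : ℕ) : ℝ)) =O[atTop] fun n => y (n + 1) - y n := by
    refine IsBigO.of_bound (2 / z) ?_
    filter_upwards [hz.eventually (lt_mem_nhds (half_lt_self hpos))] with n hn
    rw [Real.norm_of_nonneg (by positivity),
      Real.norm_of_nonneg (sub_nonneg.2 (hy (Nat.le_succ n)))]
    rw [div_le_iff₀ (by positivity)]
    push_cast
    rw [div_mul_eq_mul_div, div_mul_eq_mul_div, le_div_iff₀ hpos]
    linarith
  have h3 := summable_of_isBigO_nat h1 h2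
  exact Real.not_summable_one_div_natCast ((summable_nat_add_iff 1).1 h3)

lemma one_sub_backlogGen_nearOne (k n : ℕ) :
    Integrable (fun τ => geom1 (nearOne n) (backlog k τ)) (stacksLaw q) ∧
    (n + 1) * (1 - backlogGen q k (nearOne n))
      = ∫ τ, geom1 (nearOne n) (backlog k τ) ∂stacksLaw q := by
  have hp := integrable_pow_nat (μ := stacksLaw q) (measurable_backlog k) (nearOne_nonneg n)
    (nearOne_lt_one n).le
  have hg : ∀ τ, geom1 (nearOne n) (backlog k τ) = (n + 1) * (1 - nearOne n ^ backlog k τ) :=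
    fun τ => by
    have := one_sub_mul_geom1 (nearOne n) (backlog k τ)
    rw [one_sub_nearOne] at this
    rw [← this]; field_simp
  simp only [hg]
  refine ⟨((integrable_const _).sub hp).const_mul _, ?_⟩
  rw [integral_const_mul, integral_sub (integrable_const _) hp]
  simp [backlogGen]

/-- For `α > 1` the mean backlog converges, and its limit is given by the moment identity. -/
lemma tendsto_backlogMean (h : IsStrength M q) (hα : fullMean M q 1 < -1) :
    Tendsto (backlogMean q) atTop (𝓝 (limitBinom2 M q / (-1 - fullMean M q 1))) := by
  obtain ⟨B, hB⟩ := backlogMean_bounded h hα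
  set m := ⨆ k, backlogMean q k with hm
  have hbdd : BddAbove (Set.range (backlogMean q)) := ⟨B, by rintro _ ⟨k, rfl⟩; exact hB k⟩
  have hlim : Tendsto (backlogMean q) atTop (𝓝 m) :=
    tendsto_atTop_ciSup (backlogMean_mono h) hbdd
  have hle : ∀ k, backlogMean q k ≤ m := fun k => le_ciSup hbdd k
  suffices hz : limitBinom2 M q = (-1 - fullMean M q 1) * m by
    rw [hz, mul_div_cancel_left₀ _ (by linarith)]; exact hlim
  have hup : (-1 - fullMean M q 1) * m ≤ limitBinom2 M q := by
    refine le_of_tendsto_of_tendsto' (hlim.const_mul _)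
      ((tendsto_sum_cdf_mul h (gap2 M q)).const_add _) fun k => ?_
    have := backlogBinom2_mono h (Nat.le_add_right k 1)
    rw [backlogBinom2_succ h] at this
    linarith
  refine le_antisymm ?_ hup
  set u : ℕ → ℝ := fun n => (n + 1) * (1 - limitGen q (nearOne n)) with hu
  have hutend : ∀ n : ℕ, Tendsto (fun k => (n + 1) * (1 - backlogGen q k (nearOne n))) atTop
      (𝓝 (u n)) := fun n =>
    ((tendsto_backlogGen h (nearOne_nonneg n) (nearOne_lt_one n).le).const_sub 1).const_mul _
  have humono : Monotone u := fun a b hab =>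
    le_of_tendsto_of_tendsto' (hutend a) (hutend b) fun k => by
      rw [(one_sub_backlogGen_nearOne k a).2, (one_sub_backlogGen_nearOne k b).2]
      exact integral_mono (one_sub_backlogGen_nearOne k a).1
        (one_sub_backlogGen_nearOne k b).1 fun τ =>
          geom1_mono (nearOne_nonneg a) (nearOne_mono hab) _
  have hum : ∀ n, u n ≤ m := fun n => le_of_tendsto' (hutend n) fun k => by
    rw [(one_sub_backlogGen_nearOne k n).2]
    refine (integral_mono (one_sub_backlogGen_nearOne k n).1 (integrable_backlog h k)
      fun τ => ?_).trans (hle k)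
    have := geom1_mono (nearOne_nonneg n) (nearOne_lt_one n).le (backlog k τ)
    rwa [geom1_one] at this
  have hulim : Tendsto u atTop (𝓝 m) := by
    refine tendsto_order.2 ⟨fun a ha => ?_, fun a ha => Eventually.of_forall fun n =>
      (hum n).trans_lt ha⟩
    obtain ⟨k, hk⟩ := (hlim.eventually (lt_mem_nhds ha)).exists
    have h1 : Tendsto (fun n : ℕ => ((n : ℝ) + 1) * (1 - backlogGen q k (nearOne n))) atTop
        (𝓝 (backlogMean q k)) := by
      have h2 := ((HasExpansion.quadratic 1 0 0).sub (hasExpansion_backlogGen h k)).congr_right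
        (sub_self 1) (b' := backlogMean q k) (by ring) rfl
      refine (h2.tendsto_first.comp tendsto_inv_nat).congr fun n => ?_
      simp only [Function.comp_def, nearOne]
      have : (n : ℝ) + 1 ≠ 0 := by positivity
      field_simp
      ring
    filter_upwards [h1.eventually (lt_mem_nhds hk)] with n hn
    refine hn.trans_le (ge_of_tendsto (hutend n) ?_)
    filter_upwards [eventually_ge_atTop k] with l hl
    gcongr
    exact backlogGen_antitone h (nearOne_nonneg n) (nearOne_lt_one n).le hl
  have hexp1 : HasExpansion (fun x => 1 - fullGenFun M q 1 x * (1 / (1 + x))) 0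
      (1 + fullMean M q 1) (0 - (1 * 1 + -fullMean M q 1 * -1 + fullBinom2 M q 1 * 1)) := by
    refine (((HasExpansion.quadratic 1 0 0).sub ((hasExpansion_fullGenFun M q 1).mul
      HasExpansion.inv_one_add)).congr_right (by ring) (by ring) rfl).congr_left fun x _ => ?_
    ring
  have hexp2 : HasExpansion (fun x => fullGenFun M q 1 x
      + (∑ j ∈ Finset.range M, limitCdf q j * excessDiff M q j x) - 1) 0 0 (limitBinom2 M q) := by
    have hg := limitGap_eq h hα.le
    rw [limitGap] at hg
    refine ((((hasExpansion_fullGenFun M q 1).add (HasExpansion.sum (s := Finset.range M)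
      fun j _ => (hasExpansion_excessDiff M q j).const_mul (limitCdf q j))).sub
      (HasExpansion.quadratic 1 0 0)).congr_right (by simp) ?_ ?_).congr_left fun x _ => ?_
    · simp only [mul_neg, Finset.sum_neg_distrib, hg]; ring
    · rw [limitBinom2]; ring
    · ring
  have hdiff : ∀ n : ℕ, (u (n + 1) - u n) * (n + 1)
      = u (n + 1) * ((1 - fullGenFun M q 1 (1 / ((n : ℝ) + 1)) * (1 / (1 + 1 / ((n : ℝ) + 1))))
          / (1 / ((n : ℝ) + 1)))
        + (fullGenFun M q 1 (1 / ((n : ℝ) + 1)) + (∑ j ∈ Finset.range M,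
          limitCdf q j * excessDiff M q j (1 / ((n : ℝ) + 1))) - 1)
          / (1 / ((n : ℝ) + 1)) ^ 2 := by
    intro n
    have hx : (0 : ℝ) ≤ 1 / (n + 1) := by positivity
    have hx1 : 1 / ((n : ℝ) + 1) ≤ 1 := by
      rw [div_le_one (by positivity)]; linarith [n.cast_nonneg (α := ℝ)]
    have hG := limitGen_eq h hx hx1
    have e1 : 1 / (1 + 1 / ((n : ℝ) + 1)) = nearOne (n + 1) := by
      rw [nearOne]; push_cast; field_simp; ring
    rw [e1] at hG ⊢
    simp only [hu]
    rw [show nearOne n = 1 - 1 / ((n : ℝ) + 1) from rfl, hG]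
    have e2 : nearOne (n + 1) = ((n : ℝ) + 1) / (n + 2) := by
      rw [nearOne]; push_cast; field_simp; ring
    generalize limitGen q (nearOne (n + 1)) = g
    rw [e2]
    push_cast
    field_simp
    ring
  have hz := ((hulim.comp (tendsto_add_atTop_nat 1)).mul
    (hexp1.tendsto_first.comp tendsto_inv_nat)).add (hexp2.tendsto_second.comp tendsto_inv_nat)
  have := le_zero_of_tendsto_mul_diff humono hum (hz.congr fun n => (hdiff n).symm)
  linarith

end

lemma pow_sub_sum_mem_Icc {s : ℝ} (h0 : 0 ≤ s) (h1 : s ≤ 1) (j n : ℕ) :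
    s ^ n - ∑ i ∈ Finset.range j, (if n = i then s ^ i else 0) ∈
      Set.Icc (if n = j then s ^ j else 0) ((if n = j then s ^ j else 0) + s ^ (j + 1)) := by
  have hp := pow_nonneg h0 (j + 1)
  rw [Finset.sum_ite_eq]
  simp only [Finset.mem_range]
  rcases lt_trichotomy n j with h | h | h
  · simp [h, h.ne, hp]
  · simp [h, hp]
  · simp only [h.not_gt, h.ne', if_false, sub_zero, zero_add]
    exact ⟨pow_nonneg h0 _, pow_le_pow_of_le_one h0 h1 h⟩

lemma integral_pow_sub_sum_mem_Icc {α : Type*} [MeasurableSpace α] {N : α → ℕ}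
    (hN : Measurable N) (μ : Measure α) [IsProbabilityMeasure μ] {s : ℝ} (h0 : 0 ≤ s) (h1 : s ≤ 1)
    (j : ℕ) :
    (∫ a, s ^ N a ∂μ) - ∑ i ∈ Finset.range j, μ.real {a | N a = i} * s ^ i ∈
      Set.Icc (μ.real {a | N a = j} * s ^ j) (μ.real {a | N a = j} * s ^ j + s ^ (j + 1)) := by
  have hint : ∀ i, Integrable (fun a => if N a = i then s ^ i else 0) μ := fun i =>
    Integrable.of_bound ((measurable_of_countable fun n : ℕ => if n = i then s ^ i else 0).comp
      hN).aestronglyMeasurable (s ^ i) (ae_of_all _ fun a => by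
        split_ifs <;> simp [abs_of_nonneg h0, pow_nonneg h0])
  have hval : ∀ i, ∫ a, (if N a = i then s ^ i else 0) ∂μ = μ.real {a | N a = i} * s ^ i := by
    intro i
    have : (fun a => if N a = i then s ^ i else 0) = {a | N a = i}.indicator fun _ => s ^ i := by
      funext a; simp only [Set.indicator_apply, Set.mem_ofPred_eq]
    rw [this]
    exact integral_indicator_const (s ^ i) (hN (measurableSet_singleton i))
  have hsum := integrable_finsetSum (Finset.range j) fun i _ => hint i
  have hpow := integrable_pow_nat (μ := μ) hN h0 h1
  have heq : (∫ a, s ^ N a ∂μ) - ∑ i ∈ Finset.range j, μ.real {a | N a = i} * s ^ i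
      = ∫ a, (s ^ N a - ∑ i ∈ Finset.range j, (if N a = i then s ^ i else 0)) ∂μ := by
    rw [integral_sub hpow hsum, integral_finsetSum _ fun i _ => hint i]
    simp only [hval]
  rw [heq, ← hval j]
  refine ⟨integral_mono (hint j) (hpow.sub hsum) fun a => (pow_sub_sum_mem_Icc h0 h1 j (N a)).1, ?_⟩
  have h2 : (∫ a, (if N a = j then s ^ j else 0) ∂μ) + s ^ (j + 1)
      = ∫ a, ((if N a = j then s ^ j else 0) + s ^ (j + 1)) ∂μ := by
    rw [integral_add (hint j) (integrable_const _)]; simp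
  rw [h2]
  exact integral_mono (hpow.sub hsum) ((hint j).add (integrable_const _))
    fun a => (pow_sub_sum_mem_Icc h0 h1 j (N a)).2

/-- Pointwise convergence of generating functions implies convergence of point masses. -/
lemma tendsto_pointMass_of_tendsto_genFun {ι α : Type*} [MeasurableSpace α] {N : α → ℕ}
    (hN : Measurable N) {l : Filter ι} {μ : ι → Measure α} [∀ t, IsProbabilityMeasure (μ t)]
    {ν : Measure α} [IsProbabilityMeasure ν]
    (h : ∀ s : ℝ, 0 < s → s < 1 →
      Tendsto (fun t => ∫ a, s ^ N a ∂(μ t)) l (𝓝 (∫ a, s ^ N a ∂ν))) (j : ℕ) :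
    Tendsto (fun t => (μ t).real {a | N a = j}) l (𝓝 (ν.real {a | N a = j})) := by
  induction j using Nat.strong_induction_on with
  | _ j ih =>
    rw [Metric.tendsto_nhds]
    intro ε hε
    obtain ⟨s, hs0, hs⟩ := exists_between (show (0 : ℝ) < min 1 (ε / 3) by positivity)
    have hs1 := hs.trans_le (min_le_left _ _)
    have hs3 := hs.trans_le (min_le_right _ _)
    have hlim := (h s hs0 hs1).sub (tendsto_finsetSum (Finset.range j) fun i hi =>
      (ih i (Finset.mem_range.1 hi)).mul_const (s ^ i))
    filter_upwards [Metric.tendsto_nhds.1 hlim (ε / 3 * s ^ j) (by positivity)] with t ht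
    have h1 := integral_pow_sub_sum_mem_Icc hN (μ t) hs0.le hs1.le j
    have h2 := integral_pow_sub_sum_mem_Icc hN ν hs0.le hs1.le j
    have hp : 0 < s ^ j := by positivity
    have h3 : s ^ (j + 1) ≤ ε / 3 * s ^ j := by
      rw [pow_succ']; gcongr
    rw [Real.dist_eq, abs_lt] at ht ⊢
    obtain ⟨h1a, h1b⟩ := h1
    obtain ⟨h2a, h2b⟩ := h2
    constructor
    · refine lt_of_mul_lt_mul_right ?_ hp.le
      linarith
    · refine lt_of_mul_lt_mul_right ?_ hp.le
      linarith

section Continuity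

variable {ι : Type*} {l : Filter ι} {M : ℕ} {q : ι → ℕ → ℝ} {qc : ℕ → ℝ}

lemma tendsto_backlogCdf_of_genFun {k : ℕ}
    (h : ∀ s : ℝ, 0 ≤ s → s ≤ 1 → Tendsto (fun t => backlogGen (q t) k s) l
      (𝓝 (backlogGen qc k s))) (j : ℕ) :
    Tendsto (fun t => backlogCdf (q t) k j) l (𝓝 (backlogCdf qc k j)) := by
  have hcdf : ∀ q : ℕ → ℝ, backlogCdf q k j
      = ∑ i ∈ Finset.range (j + 1), (stacksLaw q).real {τ | backlog k τ = i} := by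
    intro q
    rw [backlogCdf, ← measureReal_biUnion_finset]
    · congr 1; ext τ; simp
    · intro a _ b _ hab
      simp only [Function.onFun, Set.disjoint_left, Set.mem_ofPred_eq]
      intro τ h1 h2; exact hab (h1.symm.trans h2)
    · exact fun i _ => measurable_backlog k (measurableSet_singleton i)
  simp only [hcdf]
  exact tendsto_finsetSum _ fun i _ => tendsto_pointMass_of_tendsto_genFun (measurable_backlog k)
    (fun s h0 h1 => h s h0.le h1.le) i

lemma tendsto_backlogGen_strength (hs : ∀ t, IsStrength M (q t)) (hc : IsStrength M qc)
    (hq : Tendsto q l (𝓝 qc)) (k : ℕ) {s : ℝ} (h0 : 0 ≤ s) (h1 : s ≤ 1) :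
    Tendsto (fun t => backlogGen (q t) k s) l (𝓝 (backlogGen qc k s)) := by
  induction k generalizing s with
  | zero => simp [backlogGen, backlog, tendsto_const_nhds]
  | succ k ih =>
    have hx0 : 0 ≤ 1 - s := by linarith
    have hx1 : 1 - s ≤ 1 := by linarith
    have e : ∀ {q}, IsStrength M q → backlogGen q (k + 1) s = fullGenFun M q 1 (1 - s)
        * backlogGen q k (1 / (1 + (1 - s)))
        + ∑ j ∈ Finset.range M, backlogCdf q k j * excessDiff M q j (1 - s) := by
      intro q h; rw [← backlogGen_succ h k hx0 hx1, sub_sub_cancel]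
    simp only [e hc, e (hs _)]
    refine (((continuous_fullGenFun M 1 (1 - s)).tendsto qc).comp hq |>.mul (ih ?_ ?_)).add
      (tendsto_finsetSum _ fun j _ => (tendsto_backlogCdf_of_genFun (fun s h0 h1 => ih h0 h1) j).mul
        (((continuous_excessDiff M j (1 - s)).tendsto qc).comp hq))
    · positivity
    · rw [div_le_one (by linarith)]; linarith

lemma tendsto_backlogCdf_strength (hs : ∀ t, IsStrength M (q t)) (hc : IsStrength M qc)
    (hq : Tendsto q l (𝓝 qc)) (k j : ℕ) :
    Tendsto (fun t => backlogCdf (q t) k j) l (𝓝 (backlogCdf qc k j)) :=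
  tendsto_backlogCdf_of_genFun (fun _ h0 h1 => tendsto_backlogGen_strength hs hc hq k h0 h1) j

/-- If each term of a finite sum is asymptotically bounded by its target and the sums converge to
the sum of targets, then each term converges. -/
lemma tendsto_of_tendsto_sum {n : ℕ} {f : ι → ℕ → ℝ} {g : ℕ → ℝ}
    (hle : ∀ i ∈ Finset.range n, ∀ ε > 0, ∀ᶠ t in l, f t i < g i + ε)
    (hsum : Tendsto (fun t => ∑ i ∈ Finset.range n, f t i) l (𝓝 (∑ i ∈ Finset.range n, g i)))
    {i : ℕ} (hi : i ∈ Finset.range n) : Tendsto (fun t => f t i) l (𝓝 (g i)) := by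
  rw [Metric.tendsto_nhds]
  intro ε hε
  have hδ : 0 < ε / (n + 1) := by positivity
  have hall : ∀ᶠ t in l, ∀ i ∈ Finset.range n, f t i < g i + ε / (n + 1) :=
    (Filter.eventually_all_finset _).2 fun i hi => hle i hi _ hδ
  filter_upwards [hall, Metric.tendsto_nhds.1 hsum _ hδ] with t ht hst
  rw [Real.dist_eq, abs_lt] at hst ⊢
  have hεn : ε / (n + 1) * (n + 1) = ε := by field_simp
  have hn : (1 : ℝ) ≤ n := by
    have := Finset.mem_range.1 hi
    exact_mod_cast (by omega : 1 ≤ n)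
  constructor
  · have h1 : ∑ x ∈ (Finset.range n).erase i, (f t x - g x)
        ≤ ∑ x ∈ (Finset.range n).erase i, ε / (n + 1) :=
      Finset.sum_le_sum fun x hx => by linarith [ht x (Finset.mem_of_mem_erase hx)]
    rw [Finset.sum_const, Finset.card_erase_of_mem hi, Finset.card_range, nsmul_eq_mul,
      Nat.cast_sub (by exact_mod_cast hn)] at h1
    have h2 := Finset.add_sum_erase (Finset.range n) (fun x => f t x - g x) hi
    simp only [Finset.sum_sub_distrib] at h1 h2
    push_cast at h1
    nlinarith
  · have := ht i hi
    have : ε / (n + 1) ≤ ε := by rw [div_le_iff₀ (by positivity)]; nlinarith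
    linarith

/-- The critical second-moment increment depends continuously on the strengths on the
side where the walk is at least critical. -/
lemma tendsto_limitBinom2 (hs : ∀ t, IsStrength M (q t)) (hc : IsStrength M qc)
    (hq : Tendsto q l (𝓝 qc)) (hα : ∀ t, fullMean M (q t) 1 ≤ -1)
    (hαc : fullMean M qc 1 ≤ -1) :
    Tendsto (fun t => limitBinom2 M (q t)) l (𝓝 (limitBinom2 M qc)) := by
  have hgap : ∀ j, Tendsto (fun t => gap M (q t) j) l (𝓝 (gap M qc j)) := fun j =>
    ((continuous_gap M j).tendsto qc).comp hq
  have hgap2 : ∀ j, Tendsto (fun t => gap2 M (q t) j) l (𝓝 (gap2 M qc j)) := fun j =>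
    ((continuous_gap2 M j).tendsto qc).comp hq
  have hterm : ∀ j ∈ Finset.range M, Tendsto (fun t => limitCdf (q t) j * gap M (q t) j) l
      (𝓝 (limitCdf qc j * gap M qc j)) := by
    intro j hj
    refine tendsto_of_tendsto_sum (f := fun t j => limitCdf (q t) j * gap M (q t) j)
      (g := fun j => limitCdf qc j * gap M qc j) (fun i _ ε hε => ?_) ?_ hj
    · have h1 := ((tendsto_backlogCdf hc i).mul_const (gap M qc i)).eventually
        (gt_mem_nhds (lt_add_of_pos_right _ hε))
      obtain ⟨k, hk⟩ := h1.exists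
      filter_upwards [((tendsto_backlogCdf_strength hs hc hq k i).mul (hgap i)).eventually
        (gt_mem_nhds hk)] with t ht
      exact (mul_le_mul_of_nonneg_right (limitCdf_le _ k i) (gap_nonneg (hs t) i)).trans_lt ht
    · have h1 := fun t => limitGap_eq (hs t) (hα t)
      have h2 := limitGap_eq hc hαc
      simp only [limitGap] at h1 h2
      simp only [h1, h2]
      exact ((((continuous_fullMean_fullBinom2 M 1).1).tendsto qc).comp hq).neg
  simp only [limitBinom2]
  refine ((((continuous_fullMean_fullBinom2 M 1).2).tendsto qc).comp hq).add
    (tendsto_finsetSum _ fun j hj => ?_)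
  by_cases hg : gap M qc j = 0
  · rw [gap2_eq_zero hc hg, mul_zero]
    have h2 := hgap2 j
    rw [gap2_eq_zero hc hg] at h2
    refine squeeze_zero_norm (fun t => ?_) (norm_zero (E := ℝ) ▸ h2.norm)
    rw [norm_mul]
    refine mul_le_of_le_one_left (norm_nonneg _) ?_
    rw [Real.norm_eq_abs, abs_of_nonneg (limitCdf_nonneg _ _)]
    exact (limitCdf_le _ 0 j).trans (backlogCdf_le_one _ _ _)
  · have h1 := ((hterm j hj).div (hgap j) hg).mul (hgap2 j)
    rw [mul_div_cancel_right₀ _ hg] at h1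
    refine h1.congr' ?_
    filter_upwards [(hgap j).eventually_ne hg] with t ht
    simp only [Pi.div_apply]
    rw [mul_div_cancel_right₀ _ ht]

end Continuity

/-- The sequence of coin strengths, indexed from zero. -/
def strengthSeq (M : ℕ) (p : Fin M → ℝ) (i : ℕ) : ℝ := strength M p (i + 1)

lemma isStrength_strengthSeq {M : ℕ} {p : Fin M → ℝ} (hp : p ∈ OmegaU M) :
    IsStrength M (strengthSeq M p) := by
  refine ⟨fun i => ?_, fun i => ?_, fun i hi => ?_⟩
  · unfold strengthSeq strength; split_ifs; exacts [(hp _).1, le_rfl]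
  · unfold strengthSeq strength; split_ifs; exacts [(hp _).2, by norm_num]
  · unfold strengthSeq strength; rw [dif_neg (by omega)]

lemma continuous_strengthSeq (M : ℕ) : Continuous (strengthSeq M) := by
  refine continuous_pi fun i => ?_
  unfold strengthSeq strength
  split_ifs
  exacts [continuous_apply _, continuous_const]

lemma fullMean_strengthSeq (M : ℕ) (p : Fin M → ℝ) :
    fullMean M (strengthSeq M p) 1 = -cookieAlpha M p := by
  have key : ∀ (M : ℕ) (q : ℕ → ℝ), fullMean M q 1 = 1 - ∑ i ∈ Finset.range M, (2 * q i - 1) := by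
    intro M
    induction M with
    | zero => intro q; simp [fullMean]
    | succ M ih => intro q; rw [fullMean, ih, Finset.sum_range_succ']; ring
  rw [key, cookieAlpha, Finset.sum_range]
  have : ∀ i : Fin M, strengthSeq M p i = p i := by
    intro i; unfold strengthSeq strength; rw [dif_pos (by omega)]; rfl
  simp only [this]; ring

/-- Position and visit counts of the walk driven by the coins `ω`: the `n`-th departure from `x`
uses the coin `ω x n`. -/
def walkState (ω : ℤ → ℕ → Bool) : ℕ → ℤ × (ℤ → ℕ)
  | 0 => (0, 0)
  | n + 1 =>
    let s := walkState ω n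
    (if ω s.1 (s.2 s.1) = true then s.1 + 1 else s.1 - 1,
      Function.update s.2 s.1 (s.2 s.1 + 1))

/-- The position of the walk driven by the coins `ω` at time `n`. -/
def pos (ω : ℤ → ℕ → Bool) (n : ℕ) : ℤ := (walkState ω n).1

/-- The number of visits to `x` strictly before time `n`. -/
def visits (ω : ℤ → ℕ → Bool) (n : ℕ) (x : ℤ) : ℕ := (walkState ω n).2 x

section Path

variable (ω : ℤ → ℕ → Bool) (n : ℕ)

@[simp] lemma pos_zero : pos ω 0 = 0 := rfl

@[simp] lemma visits_zero (x : ℤ) : visits ω 0 x = 0 := rfl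

lemma pos_succ : pos ω (n + 1) =
    if ω (pos ω n) (visits ω n (pos ω n)) = true then pos ω n + 1 else pos ω n - 1 := rfl

lemma visits_succ (x : ℤ) : visits ω (n + 1) x = visits ω n x + if pos ω n = x then 1 else 0 := by
  change Function.update (walkState ω n).2 (walkState ω n).1 _ x = _
  by_cases h : pos ω n = x
  · subst h; simp [visits, pos]
  · rw [if_neg h]; exact Function.update_of_ne (Ne.symm h) _ _

lemma visits_eq_card (x : ℤ) :
    visits ω n x = #{k ∈ Finset.range n | pos ω k = x} := by
  induction n with
  | zero => simp
  | succ n ih =>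
    rw [visits_succ, ih, Finset.range_add_one, Finset.filter_insert]
    split_ifs <;> simp

lemma abs_pos_succ_sub : |pos ω (n + 1) - pos ω n| = 1 := by
  rw [pos_succ]; split_ifs <;> simp

end Path

lemma measurable_eval_prod {α β : Type*} [Countable α] [MeasurableSpace α]
    [MeasurableSingletonClass α] [MeasurableSpace β] :
    Measurable fun z : α × (α → β) => z.2 z.1 :=
  measurable_from_prod_countable_right fun a => measurable_pi_apply a

lemma measurable_walkState (n : ℕ) :
    Measurable (fun ω => pos ω n) ∧ ∀ x, Measurable fun ω => visits ω n x := by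
  induction n with
  | zero => exact ⟨measurable_const, fun x => measurable_const⟩
  | succ n ih =>
    obtain ⟨h1, h2⟩ := ih
    have h3 : Measurable fun ω => visits ω n (pos ω n) :=
      measurable_eval_prod.comp (h1.prodMk (measurable_pi_lambda _ h2))
    have h4 : Measurable fun ω : ℤ → ℕ → Bool => ω (pos ω n) (visits ω n (pos ω n)) :=
      measurable_eval_prod.comp (h3.prodMk (measurable_eval_prod.comp (h1.prodMk measurable_id)))
    constructor
    · simp only [pos_succ]
      exact Measurable.ite (h4 (measurableSet_singleton true)) (h1.add_const 1) (h1.sub_const 1)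
    · intro x
      simp only [visits_succ]
      exact (h2 x).add (Measurable.ite (h1 (measurableSet_singleton x)) measurable_const
        measurable_const)

/-- The law of the full field of coins. -/
def fieldLaw (q : ℕ → ℝ) : Measure (ℤ → ℕ → Bool) := Measure.infinitePi fun _ => stackLaw q

instance (q : ℕ → ℝ) : IsProbabilityMeasure (fieldLaw q) := by
  unfold fieldLaw; infer_instance

lemma iIndepFun_coins (q : ℕ → ℝ) :
    iIndepFun (fun (z : ℤ × ℕ) (ω : ℤ → ℕ → Bool) => ω z.1 z.2) (fieldLaw q) :=
  iIndepFun_uncurry_infinitePi' (X := fun _ _ b => b) (fun _ i => coin (q i))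
    (fun _ _ => measurable_id)

lemma fieldLaw_coin {M : ℕ} {q : ℕ → ℝ} (h : IsStrength M q) (x : ℤ) (i : ℕ) :
    fieldLaw q {ω | ω x i = true} = ENNReal.ofReal (q i) := by
  rw [← coin_true (h.nonneg i) (h.lt_one i).le, ← Measure.infinitePi_map_eval
    (fun i => coin (q i)) i, Measure.map_apply (measurable_pi_apply i) (measurableSet_singleton _)]
  change _ = stackLaw q _
  rw [← Measure.infinitePi_map_eval (fun _ : ℤ => stackLaw q) x,
    Measure.map_apply (measurable_pi_apply x)
      ((measurable_pi_apply i) (measurableSet_singleton _))]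
  rfl

/-- An event determined by finitely many coins is independent of any other coin. -/
lemma fieldLaw_inter_coin {M : ℕ} {q : ℕ → ℝ} (h : IsStrength M q) {E : Set (ℤ → ℕ → Bool)}
    {S : Finset (ℤ × ℕ)} (hE : ∀ ω ω', (∀ z ∈ S, ω z.1 z.2 = ω' z.1 z.2) → ω ∈ E → ω' ∈ E)
    {z : ℤ × ℕ} (hz : z ∉ S) :
    fieldLaw q (E ∩ {ω | ω z.1 z.2 = true}) = ENNReal.ofReal (q z.2) * fieldLaw q E := by
  have hmeas : ∀ z : ℤ × ℕ, Measurable fun ω : ℤ → ℕ → Bool => ω z.1 z.2 := fun z =>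
    (measurable_pi_apply z.2).comp (measurable_pi_apply z.1)
  have hind := (iIndepFun_coins q).indepFun_finset S {z}
    (Finset.disjoint_singleton_right.2 hz) hmeas
  set f : (ℤ → ℕ → Bool) → S → Bool := fun ω i => ω i.1.1 i.1.2 with hf
  have hEf : E = f ⁻¹' (f '' E) := by
    refine (Set.subset_preimage_image f E).antisymm ?_
    rintro ω ⟨ω', hω', heq⟩
    exact hE ω' ω (fun z hz => congrFun heq ⟨z, hz⟩) hω'
  have := hind.measure_inter_preimage_eq_mul (f '' E)
    {b | b ⟨z, Finset.mem_singleton_self z⟩ = true} (Set.toFinite _).measurableSet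
    (Set.toFinite _).measurableSet
  rw [← hEf] at this
  rw [mul_comm, ← fieldLaw_coin h z.1 z.2]
  exact this

theorem isCookieRW_pos {M : ℕ} {p : Fin M → ℝ} (hp : p ∈ OmegaU M) :
    IsCookieRW M p (fieldLaw (strengthSeq M p)) fun n ω => pos ω n where
  isProb := inferInstance
  meas n := (measurable_walkState n).1
  init := by simp
  nearest := by simp [abs_pos_succ_sub]
  step n x := by
    set c : ℕ → ℕ := fun k => #{i ∈ Finset.range k | x i = x k} with hc
    have hcard : #{i ∈ Finset.range (n + 1) | x i = x n} = c n + 1 := by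
      rw [Finset.range_add_one, Finset.filter_insert, if_pos rfl, Finset.card_insert_of_notMem
        (by simp)]
    have hvis : ∀ ω k, (∀ i ≤ k, pos ω i = x i) → visits ω k (x k) = c k := by
      intro ω k h
      rw [visits_eq_card, hc]
      congr 1
      refine Finset.filter_congr fun i hi => ?_
      rw [h i (Finset.mem_range.1 hi).le]
    rw [hcard]
    have hset : {ω | (∀ k ≤ n, pos ω k = x k) ∧ pos ω (n + 1) = x n + 1}
        = {ω | ∀ k ≤ n, pos ω k = x k} ∩ {ω | ω (x n) (c n) = true} := by
      ext ω
      simp only [Set.mem_ofPred_eq, Set.mem_inter_iff]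
      refine and_congr_right fun h => ?_
      rw [pos_succ, h n le_rfl, hvis ω n h]
      split_ifs with hb
      · simp [hb]
      · exact iff_of_false (by omega) hb
    rw [hset]
    refine fieldLaw_inter_coin (isStrength_strengthSeq hp) (z := (x n, c n))
      (S := (Finset.range n).image fun k => (x k, c k)) ?_ ?_
    · intro ω ω' hagree hω
      have hcoin : ∀ k < n, ω (x k) (c k) = ω' (x k) (c k) := fun k hk =>
        hagree (x k, c k) (Finset.mem_image_of_mem _ (Finset.mem_range.2 hk))
      have hω : ∀ k ≤ n, pos ω k = x k := hω
      change ∀ k ≤ n, pos ω' k = x k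
      have : ∀ k ≤ n, ∀ i ≤ k, pos ω' i = x i := by
        intro k
        induction k with
        | zero => intro _ i hi; rw [Nat.le_zero.1 hi, ← hω 0 (Nat.zero_le _)]; simp
        | succ k ih =>
          intro hk i hi
          have hk' := ih (by omega)
          rcases Nat.le_succ_iff.1 hi with hi | rfl
          · exact hk' i hi
          · rw [← hω _ hk, pos_succ, pos_succ, hk' k le_rfl, hvis ω' k hk', hω k (by omega),
              hvis ω k fun i hi => hω i (by omega), hcoin k (by omega)]
      exact fun k hk => this k hk k le_rfl
    · simp only [Finset.mem_image, Finset.mem_range, Prod.mk.injEq, not_exists, not_and]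
      intro k hk hxk hck
      have : c k < c n := by
        refine Finset.card_lt_card ⟨fun i hi => ?_, fun hsub => ?_⟩
        · simp only [Finset.mem_filter, Finset.mem_range] at hi ⊢
          exact ⟨by omega, hi.2.trans hxk⟩
        · have := hsub (Finset.mem_filter.2 ⟨Finset.mem_range.2 hk, hxk⟩)
          simp at this
      omega

section Deterministic

variable (ω : ℤ → ℕ → Bool) (t : ℕ)

/-- The number of jumps to the left from `x` before time `t`. -/
def leftJumps (x : ℤ) : ℕ := visits ω t x - heads (ω x) (visits ω t x)

lemma heads_add_leftJumps (x : ℤ) :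
    heads (ω x) (visits ω t x) + leftJumps ω t x = visits ω t x :=
  Nat.add_sub_cancel' (heads_le _ _)

lemma heads_visits_succ (x : ℤ) : heads (ω x) (visits ω (t + 1) x)
    = heads (ω x) (visits ω t x) + if pos ω t = x ∧ pos ω (t + 1) = x + 1 then 1 else 0 := by
  rw [visits_succ, pos_succ]
  by_cases h : pos ω t = x
  · subst h
    rw [if_pos rfl, heads_succ]
    split_ifs <;> first | rfl | omega
  · simp [h]

lemma leftJumps_succ (x : ℤ) : leftJumps ω (t + 1) x
    = leftJumps ω t x + if pos ω t = x ∧ pos ω (t + 1) = x - 1 then 1 else 0 := by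
  have h1 := heads_add_leftJumps ω t x
  have h2 := heads_add_leftJumps ω (t + 1) x
  have h3 := heads_visits_succ ω t x
  have h4 := visits_succ ω t x
  have h5 := pos_succ ω t
  split_ifs at * <;> omega

/-- Net flow through the edge from `x ≥ 0` to `x + 1`. -/
lemma heads_eq_leftJumps_add {x : ℤ} (hx : 0 ≤ x) : heads (ω x) (visits ω t x)
    = leftJumps ω t (x + 1) + if x < pos ω t then 1 else 0 := by
  induction t with
  | zero => simp [leftJumps, heads, hx.not_gt]
  | succ t ih =>
    rw [heads_visits_succ, leftJumps_succ, ih]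
    have h5 := pos_succ ω t
    split_ifs at * <;> omega

lemma last_coin_eq_true {x : ℤ} (hx : x < pos ω t) (hc : 0 < visits ω t x) :
    ω x (visits ω t x - 1) = true := by
  induction t with
  | zero => simp at hc
  | succ t ih =>
    rw [visits_succ] at hc ⊢
    rw [pos_succ] at hx
    by_cases h : pos ω t = x
    · subst h
      simp only [if_true, Nat.add_sub_cancel]
      by_contra hb
      rw [if_neg hb] at hx
      omega
    · rw [if_neg h, add_zero] at hc ⊢
      exact ih (by split_ifs at hx <;> omega) hc

end Deterministic

lemma Good.sub_heads_le_failures {σ : ℕ → Bool} (h : Good σ) (c : ℕ) :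
    c - heads σ c ≤ failures σ (heads σ c + 1) := by
  by_contra! hlt
  have h1 := h.failures_le_iff.1 (Nat.le_sub_one_of_lt hlt)
  have h2 : c - heads σ c - 1 + (heads σ c + 1) = c := by omega
  rw [h2] at h1
  omega

lemma Good.failures_heads {σ : ℕ → Bool} (h : Good σ) {c : ℕ} (hc : 0 < c)
    (hlast : σ (c - 1) = true) : failures σ (heads σ c) = c - heads σ c := by
  have hle := heads_le σ c
  refine le_antisymm (h.failures_le_iff.2 (by rw [Nat.sub_add_cancel hle])) ?_
  by_contra! hlt
  have h1 := h.failures_le_iff.1 (Nat.le_sub_one_of_lt hlt)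
  have h2 : c - heads σ c - 1 + heads σ c = c - 1 := by omega
  rw [h2] at h1
  have h3 := heads_succ σ (c - 1)
  rw [Nat.sub_add_cancel hc, if_pos hlast] at h3
  omega

/-- The backlog chain of length `k` read off from the coins to the right of `x`. -/
def fieldBacklog (ω : ℤ → ℕ → Bool) (k : ℕ) (x : ℤ) : ℕ := backlog k fun i => ω (x + i)

@[simp] lemma fieldBacklog_zero (ω : ℤ → ℕ → Bool) (x : ℤ) : fieldBacklog ω 0 x = 0 := rfl

lemma fieldBacklog_succ (ω : ℤ → ℕ → Bool) (k : ℕ) (x : ℤ) :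
    fieldBacklog ω (k + 1) x = failures (ω x) (fieldBacklog ω k (x + 1) + 1) := by
  simp only [fieldBacklog, backlog, Nat.cast_zero, add_zero]
  congr 4
  funext i
  congr 1
  push_cast; ring

section Hitting

variable {ω : ℤ → ℕ → Bool} {n t : ℕ}

lemma leftJumps_eq_zero (h : ∀ k < t, pos ω k < n) : leftJumps ω t n = 0 := by
  have : visits ω t n = 0 := by
    rw [visits_eq_card, Finset.card_eq_zero, Finset.filter_eq_empty_iff]
    exact fun k hk => (h k (Finset.mem_range.1 hk)).ne
  simp [leftJumps, this]

/-- Before the walk has hit `n`, the left jumps are dominated by the backlog chain. -/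
lemma leftJumps_le_fieldBacklog (hg : ∀ x, Good (ω x)) (h : ∀ k < t, pos ω k < n) {k : ℕ}
    (hk : k ≤ n) : leftJumps ω t (n - k : ℤ) ≤ fieldBacklog ω k (n - k : ℤ) := by
  induction k with
  | zero => simp [leftJumps_eq_zero h]
  | succ k ih =>
    have ih := ih (by omega)
    set x : ℤ := n - (k + 1 : ℕ) with hx
    have hx1 : (n - k : ℤ) = x + 1 := by rw [hx]; push_cast; ring
    rw [hx1] at ih
    rw [fieldBacklog_succ]
    have hflow := heads_eq_leftJumps_add ω t (x := x) (by omega)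
    rcases Nat.eq_zero_or_pos (visits ω t x) with hc | hc
    · simp [leftJumps, hc]
    by_cases hlt : x < pos ω t
    · rw [if_pos hlt] at hflow
      have := (hg x).failures_heads hc (last_coin_eq_true ω t hlt hc)
      rw [leftJumps, ← this]
      exact (hg x).failures_mono (by omega)
    · rw [if_neg hlt] at hflow
      exact ((hg x).sub_heads_le_failures _).trans ((hg x).failures_mono (by omega))

/-- When the walk first hits `n`, the left jumps are given by the backlog chain. -/
lemma leftJumps_eq_fieldBacklog (hg : ∀ x, Good (ω x)) (h : ∀ k < t, pos ω k < n)
    (ht : pos ω t = n) {k : ℕ} (hk : k ≤ n) :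
    leftJumps ω t (n - k : ℤ) = fieldBacklog ω k (n - k : ℤ) := by
  induction k with
  | zero => simp [leftJumps_eq_zero h]
  | succ k ih =>
    have ih := ih (by omega)
    set x : ℤ := n - (k + 1 : ℕ) with hx
    have hx1 : (n - k : ℤ) = x + 1 := by rw [hx]; push_cast; ring
    rw [hx1] at ih
    rw [fieldBacklog_succ, ← ih]
    have hlt : x < pos ω t := by omega
    have hflow := heads_eq_leftJumps_add ω t (x := x) (by omega)
    rw [if_pos hlt] at hflow
    have hle := heads_le (ω x) (visits ω t x)
    have hc : 0 < visits ω t x := by omega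
    rw [← hflow, (hg x).failures_heads hc (last_coin_eq_true ω t hlt hc), leftJumps]

/-- The time spent strictly below zero before time `t`. -/
def negTime (ω : ℤ → ℕ → Bool) (t : ℕ) : ℕ := #{k ∈ Finset.range t | pos ω k < 0}

lemma time_eq (h : ∀ k < t, pos ω k < n) :
    t = negTime ω t + ∑ x ∈ Finset.range n, visits ω t x := by
  have h1 : (Finset.range t).filter (fun k => ¬ pos ω k < 0)
      = (Finset.range n).biUnion fun x => {k ∈ Finset.range t | pos ω k = x} := by
    ext k
    simp only [Finset.mem_filter, Finset.mem_range, Finset.mem_biUnion]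
    constructor
    · rintro ⟨hk, hp⟩
      have := h k hk
      exact ⟨(pos ω k).toNat, by omega, hk, by omega⟩
    · rintro ⟨x, _, hk, hp⟩
      exact ⟨hk, by omega⟩
  have h2 := Finset.card_filter_add_card_filter_not (s := Finset.range t) fun k => pos ω k < 0
  rw [h1, Finset.card_biUnion, Finset.card_range] at h2
  · simp only [visits_eq_card]; exact h2.symm
  · intro x _ y _ hxy
    refine Finset.disjoint_left.2 fun k hk hk' => hxy ?_
    simp only [Finset.mem_filter] at hk hk'
    exact_mod_cast hk.2.symm.trans hk'.2

lemma visits_eq (x : ℕ) : visits ω t x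
    = leftJumps ω t x + leftJumps ω t (x + 1 : ℕ) + if (x : ℤ) < pos ω t then 1 else 0 := by
  have h1 := heads_add_leftJumps ω t x
  have h2 := heads_eq_leftJumps_add ω t (x := x) (by omega)
  push_cast
  omega

/-- The total backlog seen from level `n`. -/
def totalBacklog (ω : ℤ → ℕ → Bool) (n : ℕ) : ℕ :=
  ∑ x ∈ Finset.range n, fieldBacklog ω (n - x) x

lemma time_le (hg : ∀ x, Good (ω x)) (h : ∀ k < t, pos ω k < n) :
    t ≤ negTime ω t + n + 2 * totalBacklog ω n := by
  have hW : ∀ x ∈ Finset.range n, leftJumps ω t x ≤ fieldBacklog ω (n - x) x := by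
    intro x hx
    have hx := (Finset.mem_range.1 hx).le
    have := leftJumps_le_fieldBacklog hg h (k := n - x) (by omega)
    rwa [Nat.cast_sub hx, sub_sub_cancel] at this
  have h0 : ∑ x ∈ Finset.range n, leftJumps ω t x ≤ totalBacklog ω n := Finset.sum_le_sum hW
  have h1 : ∑ x ∈ Finset.range n, leftJumps ω t (x + 1 : ℕ)
      ≤ ∑ x ∈ Finset.range n, leftJumps ω t x := by
    have e1 := Finset.sum_range_succ (fun x : ℕ => leftJumps ω t x) n
    have e2 := Finset.sum_range_succ' (fun x : ℕ => leftJumps ω t x) n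
    rw [leftJumps_eq_zero h] at e1
    omega
  have h2 : ∑ x ∈ Finset.range n, visits ω t x ≤ ∑ x ∈ Finset.range n,
      (leftJumps ω t x + leftJumps ω t (x + 1 : ℕ) + 1) := by
    refine Finset.sum_le_sum fun x _ => ?_
    rw [visits_eq]; split_ifs <;> omega
  rw [Finset.sum_add_distrib, Finset.sum_add_distrib] at h2
  have h3 := time_eq h
  simp only [Finset.sum_const, Finset.card_range, smul_eq_mul, mul_one] at h2
  omega

lemma le_hitting_time (hg : ∀ x, Good (ω x)) (h : ∀ k < t, pos ω k < n) (ht : pos ω t = n) :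
    n + 2 * totalBacklog ω n ≤ t + 2 * fieldBacklog ω n 0 := by
  have hW : ∀ x ∈ Finset.range n, leftJumps ω t x = fieldBacklog ω (n - x) x := by
    intro x hx
    have hx := (Finset.mem_range.1 hx).le
    have := leftJumps_eq_fieldBacklog hg h ht (k := n - x) (by omega)
    rwa [Nat.cast_sub hx, sub_sub_cancel] at this
  have h0 : ∑ x ∈ Finset.range n, leftJumps ω t x = totalBacklog ω n := Finset.sum_congr rfl hW
  have hW0 : leftJumps ω t 0 = fieldBacklog ω n 0 := by
    have := leftJumps_eq_fieldBacklog hg h ht (k := n) le_rfl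
    rwa [sub_self] at this
  have h1 : ∑ x ∈ Finset.range n, leftJumps ω t (x + 1 : ℕ) + leftJumps ω t 0
      = ∑ x ∈ Finset.range n, leftJumps ω t x := by
    have e1 := Finset.sum_range_succ (fun x : ℕ => leftJumps ω t x) n
    have e2 := Finset.sum_range_succ' (fun x : ℕ => leftJumps ω t x) n
    rw [leftJumps_eq_zero h] at e1
    simp only [Nat.cast_zero] at e2
    omega
  have h2 : ∑ x ∈ Finset.range n, visits ω t x = ∑ x ∈ Finset.range n,
      (leftJumps ω t x + leftJumps ω t (x + 1 : ℕ) + 1) := by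
    refine Finset.sum_congr rfl fun x hx => ?_
    have := Finset.mem_range.1 hx
    rw [visits_eq, if_pos (by omega)]
  rw [Finset.sum_add_distrib, Finset.sum_add_distrib] at h2
  have h3 := time_eq h
  simp only [Finset.sum_const, Finset.card_range, smul_eq_mul, mul_one] at h2
  omega

/-- The walk does not go below zero before hitting `n` if the backlog at zero vanishes. -/
lemma negTime_eq_zero (hg : ∀ x, Good (ω x)) (h : ∀ k < t, pos ω k < n)
    (h0 : fieldBacklog ω n 0 = 0) : negTime ω t = 0 := by
  have hL : leftJumps ω t 0 = 0 := by
    have := leftJumps_le_fieldBacklog hg h (k := n) le_rfl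
    rw [sub_self] at this
    omega
  have hmono : Monotone fun k => leftJumps ω k 0 :=
    monotone_nat_of_le_succ fun k => by rw [leftJumps_succ]; omega
  have hpos : ∀ k ≤ t, 0 ≤ pos ω k := by
    intro k
    induction k with
    | zero => simp
    | succ k ih =>
      intro hk
      have ih := ih (by omega)
      by_contra! hneg
      have h1 := leftJumps_succ ω k 0
      have h2 := pos_succ ω k
      have h3 := hmono hk
      rw [if_pos ⟨by split_ifs at h2 <;> omega, by split_ifs at h2 <;> omega⟩] at h1
      simp only at h3
      omega
  rw [negTime, Finset.card_eq_zero, Finset.filter_eq_empty_iff]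
  exact fun k hk => not_lt.2 (hpos k (Finset.mem_range.1 hk).le)

end Hitting

/-- A one-sided Fatou lemma with a constant lower limit. -/
lemma le_of_ae_eventually_ge {α : Type*} [MeasurableSpace α] {μ : Measure α}
    [IsProbabilityMeasure μ] {f : ℕ → α → ℝ} {b : ℕ → ℝ} {B K c : ℝ}
    (hf : ∀ n, Integrable (f n) μ) (hK : ∀ n a, -K ≤ f n a)
    (hlim : ∀ᵐ a ∂μ, ∀ c' < c, ∀ᶠ n in atTop, c' ≤ f n a)
    (hb : ∀ n, ∫ a, f n a ∂μ ≤ b n) (hB : Tendsto b atTop (𝓝 B)) : c ≤ B := by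
  have hmin : Tendsto (fun n => ∫ a, min (f n a) c ∂μ) atTop (𝓝 (∫ _, c ∂μ)) := by
    refine tendsto_integral_of_dominated_convergence (fun _ => |K| + |c|)
      (fun n => ((hf n).aestronglyMeasurable).inf aestronglyMeasurable_const)
      (integrable_const _) (fun n => ae_of_all _ fun a => ?_) ?_
    · rw [Real.norm_eq_abs, abs_le]
      have := hK n a
      constructor
      · refine le_min ?_ ?_ <;> linarith [le_abs_self K, neg_abs_le c, abs_nonneg c, abs_nonneg K]
      · exact (min_le_right _ _).trans (by linarith [le_abs_self c, abs_nonneg K])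
    · filter_upwards [hlim] with a ha
      rw [Metric.tendsto_nhds]
      intro ε hε
      filter_upwards [ha (c - ε / 2) (by linarith)] with n hn
      rw [Real.dist_eq, abs_lt]
      constructor
      · have : c - ε / 2 ≤ min (f n a) c := le_min hn (by linarith)
        linarith
      · linarith [min_le_right (f n a) c]
  rw [integral_const, probReal_univ, one_smul] at hmin
  refine le_of_tendsto_of_tendsto' hmin hB fun n => (integral_mono ?_ (hf n) fun a =>
    min_le_left _ _).trans (hb n)
  exact (hf n).inf (integrable_const c)

section Averages

variable {q : ℕ → ℝ}

lemma measurable_shift (x : ℤ) :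
    Measurable fun (ω : ℤ → ℕ → Bool) (i : ℕ) => ω (x + i) :=
  measurable_pi_lambda _ fun _ => measurable_pi_apply _

lemma map_shift (q : ℕ → ℝ) (x : ℤ) :
    (fieldLaw q).map (fun ω (i : ℕ) => ω (x + i)) = stacksLaw q :=
  Measure.map_infinitePi_infinitePi_of_inj (P := fun _ : ℤ => stackLaw q)
    (f := fun i : ℕ => x + i) fun a b h => by simpa using h

lemma integral_fieldBacklog (φ : ℕ → ℝ) (k : ℕ) (x : ℤ) :
    ∫ ω, φ (fieldBacklog ω k x) ∂fieldLaw q = ∫ τ, φ (backlog k τ) ∂stacksLaw q := by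
  rw [← map_shift q x, integral_map (measurable_shift x).aemeasurable]
  · rfl
  · exact ((measurable_of_countable φ).comp (measurable_backlog k)).aestronglyMeasurable

lemma integrable_fieldBacklog {φ : ℕ → ℝ} {k : ℕ}
    (h : Integrable (fun τ => φ (backlog k τ)) (stacksLaw q)) (x : ℤ) :
    Integrable (fun ω => φ (fieldBacklog ω k x)) (fieldLaw q) := by
  rw [← map_shift q x] at h
  exact h.comp_measurable (measurable_shift x)

lemma integrable_average {φ : ℕ → ℝ}
    (h : ∀ k, Integrable (fun τ => φ (backlog k τ)) (stacksLaw q)) (n : ℕ) :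
    Integrable (fun ω => (n : ℝ)⁻¹ * ∑ x ∈ Finset.range n, φ (fieldBacklog ω (n - x) x))
      (fieldLaw q) :=
  (integrable_finsetSum _ fun _ _ => integrable_fieldBacklog (h _) _).const_mul _

lemma integral_average {φ : ℕ → ℝ}
    (h : ∀ k, Integrable (fun τ => φ (backlog k τ)) (stacksLaw q)) (n : ℕ) :
    ∫ ω, (n : ℝ)⁻¹ * ∑ x ∈ Finset.range n, φ (fieldBacklog ω (n - x) x) ∂fieldLaw q
      = (n : ℝ)⁻¹ * ∑ k ∈ Finset.range n, ∫ τ, φ (backlog (k + 1) τ) ∂stacksLaw q := by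
  rw [integral_const_mul, integral_finsetSum _ fun x _ => integrable_fieldBacklog (h _) _,
    ← Finset.sum_range_reflect]
  congr 1
  refine Finset.sum_congr rfl fun x hx => ?_
  rw [integral_fieldBacklog, show n - (n - 1 - x) = x + 1 by have := Finset.mem_range.1 hx; omega]

lemma ae_forall_good_field {M : ℕ} (h : IsStrength M q) :
    ∀ᵐ ω ∂fieldLaw q, ∀ x, Good (ω x) := by
  rw [ae_all_iff]
  intro x
  have h2 := ae_good h
  rw [← Measure.infinitePi_map_eval (fun _ : ℤ => stackLaw q) x] at h2
  exact ae_of_ae_map (measurable_pi_apply x).aemeasurable h2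

end Averages

section Speed

variable {ω : ℤ → ℕ → Bool} {v : ℝ}

lemma pos_le (ω : ℤ → ℕ → Bool) (t : ℕ) : pos ω t ≤ t := by
  induction t with
  | zero => simp
  | succ t ih => rw [pos_succ]; split_ifs <;> push_cast <;> omega

lemma eventually_pos_lt (hv : v ≤ 0)
    (h : Tendsto (fun t => (pos ω t : ℝ) / t) atTop (𝓝 v)) (C : ℕ) (hC : 0 < C) :
    ∀ᶠ n : ℕ in atTop, ∀ k < C * n, pos ω k < n := by
  have hC' : (0 : ℝ) < 1 / C := by positivity
  obtain ⟨k₀, hk₀⟩ := eventually_atTop.1 (h.eventually (gt_mem_nhds (hv.trans_lt hC')))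
  filter_upwards [eventually_ge_atTop (k₀ + 1)] with n hn k hk
  by_cases hkk : k₀ + 1 ≤ k
  · have h1 := hk₀ k (by omega)
    have hk0 : (0 : ℝ) < k := by exact_mod_cast (by omega : 0 < k)
    rw [div_lt_div_iff₀ hk0 (by positivity), one_mul] at h1
    have h2 : (k : ℝ) < C * n := by exact_mod_cast hk
    have h3 : (pos ω k : ℝ) < n := by
      have : (pos ω k : ℝ) * C < n * C := by linarith
      exact lt_of_mul_lt_mul_right this (by positivity)
    exact_mod_cast h3
  · have := pos_le ω k
    omega

lemma negTime_bounded (hv : 0 < v) (h : Tendsto (fun t => (pos ω t : ℝ) / t) atTop (𝓝 v)) :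
    ∃ B, ∀ t, negTime ω t ≤ B := by
  obtain ⟨k₀, hk₀⟩ := eventually_atTop.1 (h.eventually (lt_mem_nhds hv))
  refine ⟨k₀, fun t => ?_⟩
  have : {k ∈ Finset.range t | pos ω k < 0} ⊆ Finset.range k₀ := by
    intro k hk
    rw [Finset.mem_filter] at hk
    rw [Finset.mem_range]
    by_contra! hle
    have h1 := hk₀ k hle
    have h2 : (pos ω k : ℝ) ≤ 0 := by exact_mod_cast hk.2.le
    exact absurd h1 (not_lt.2 (div_nonpos_of_nonpos_of_nonneg h2 (Nat.cast_nonneg _)))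
  simpa [negTime] using Finset.card_le_card this

lemma exists_hitting_times (hv : 0 < v)
    (h : Tendsto (fun t => (pos ω t : ℝ) / t) atTop (𝓝 v)) :
    ∃ T : ℕ → ℕ, (∀ n : ℕ, (∀ k < T n, pos ω k < n) ∧ pos ω (T n) = n) ∧
      Tendsto (fun n => (T n : ℝ) / n) atTop (𝓝 (1 / v)) := by
  have hex : ∀ n : ℕ, ∃ t, (n : ℤ) ≤ pos ω t := by
    intro n
    have h1 : Tendsto (fun t => (pos ω t : ℝ)) atTop atTop := by
      refine (h.pos_mul_atTop hv tendsto_natCast_atTop_atTop).congr' ?_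
      filter_upwards [eventually_gt_atTop 0] with t ht
      field_simp
    obtain ⟨t, ht⟩ := (h1.eventually_ge_atTop (n : ℝ)).exists
    exact ⟨t, by exact_mod_cast ht⟩
  let T : ℕ → ℕ := fun n => Nat.find (hex n)
  have hT : ∀ n : ℕ, (∀ k < T n, pos ω k < n) ∧ pos ω (T n) = n := by
    intro n
    have h1 : ∀ k < T n, pos ω k < n := fun k hk => not_le.1 (Nat.find_min (hex n) hk)
    refine ⟨h1, le_antisymm ?_ (Nat.find_spec (hex n))⟩
    rcases Nat.eq_zero_or_pos (T n) with h0 | h0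
    · rw [h0]; simp
    · have h2 := h1 (T n - 1) (by omega)
      have h3 := pos_succ ω (T n - 1)
      rw [Nat.sub_add_cancel h0] at h3
      split_ifs at h3 <;> omega
  refine ⟨T, hT, ?_⟩
  have hTn : Tendsto T atTop atTop := by
    refine tendsto_atTop_mono (fun n => ?_) tendsto_id
    have := pos_le ω (T n)
    rw [(hT n).2] at this
    exact_mod_cast this
  have h2 := (h.comp hTn).inv₀ hv.ne'
  rw [← one_div] at h2
  refine h2.congr fun n => ?_
  simp only [Function.comp_apply, inv_div, (hT n).2, Int.cast_natCast]

end Speed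

section Law

variable {M : ℕ} {q : ℕ → ℝ} {v : ℝ}

lemma totalBacklog_div (ω : ℤ → ℕ → Bool) (n : ℕ) : (totalBacklog ω n : ℝ) / n
    = (n : ℝ)⁻¹ * ∑ x ∈ Finset.range n, (fieldBacklog ω (n - x) x : ℝ) := by
  rw [totalBacklog]; push_cast; rw [div_eq_inv_mul]

lemma speed_pos (h : IsStrength M q) {B : ℝ} (hB : ∀ k, backlogMean q k ≤ B)
    (hv : ∀ᵐ ω ∂fieldLaw q, Tendsto (fun t => (pos ω t : ℝ) / t) atTop (𝓝 v)) : 0 < v := by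
  by_contra! hv0
  obtain ⟨c, hc, hcdf⟩ := exists_le_backlogCdf_zero h hB
  have key : ∀ C : ℕ, (C : ℝ) ≤ B + C * (1 - c) := by
    intro C
    let φ : ℕ → ℝ := fun z => if z = 0 then 0 else C
    have hφ0 : ∀ z, 0 ≤ φ z := fun z => by simp only [φ]; split_ifs <;> positivity
    have hφi : ∀ k, Integrable (fun τ => φ (backlog k τ)) (stacksLaw q) := fun k =>
      Integrable.of_bound ((measurable_of_countable φ).comp
        (measurable_backlog k)).aestronglyMeasurable C (ae_of_all _ fun τ => by
          rw [Real.norm_eq_abs, abs_of_nonneg (hφ0 _)]; simp only [φ]; split_ifs <;> simp)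
    have hφ : ∀ k, ∫ τ, φ (backlog k τ) ∂stacksLaw q ≤ C * (1 - c) := by
      intro k
      have e : (fun τ => φ (backlog k τ))
          = {τ | backlog k τ ≤ 0}ᶜ.indicator fun _ => (C : ℝ) := by
        funext τ
        simp only [φ, Set.indicator_apply, Set.mem_compl_iff, Set.mem_ofPred_eq, Nat.le_zero]
        split_ifs <;> simp_all
      rw [e, integral_indicator_const _ (measurableSet_backlog_le k 0).compl,
        probReal_compl_eq_one_sub (measurableSet_backlog_le k 0), smul_eq_mul, mul_comm]
      have := hcdf k
      rw [backlogCdf] at this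
      gcongr
    refine le_of_ae_eventually_ge (μ := fieldLaw q) (K := 0)
      (f := fun n ω => (n : ℝ)⁻¹ * ∑ x ∈ Finset.range n, (fieldBacklog ω (n - x) x : ℝ)
        + φ (fieldBacklog ω n 0)) (b := fun _ => B + C * (1 - c))
      (fun n => (integrable_average (integrable_backlog h) n).add (integrable_fieldBacklog (hφi n) 0))
      (fun n ω => ?_) ?_ (fun n => ?_) tendsto_const_nhds
    · rw [neg_zero]
      exact add_nonneg (by positivity) (hφ0 _)
    · filter_upwards [hv, ae_forall_good_field h] with ω hω hg c' hc'
      filter_upwards [eventually_pos_lt hv0 hω (2 * C + 1) (by omega), eventually_gt_atTop 0]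
        with n hn hn0
      have hn0' : (0 : ℝ) < n := by exact_mod_cast hn0
      refine hc'.le.trans ?_
      rw [← totalBacklog_div]
      by_cases hW : fieldBacklog ω n 0 = 0
      · have h1 := time_le hg hn
        rw [negTime_eq_zero hg hn hW, zero_add] at h1
        have h2 : C * n ≤ totalBacklog ω n := by nlinarith
        have h3 : (C : ℝ) ≤ totalBacklog ω n / n := by
          rw [le_div_iff₀ hn0']; exact_mod_cast h2
        exact h3.trans (le_add_of_nonneg_right (hφ0 _))
      · have : φ (fieldBacklog ω n 0) = C := if_neg hW
        rw [this]
        exact le_add_of_nonneg_left (by positivity)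
    · rw [integral_add (integrable_average (integrable_backlog h) n)
        (integrable_fieldBacklog (hφi n) 0), integral_average (integrable_backlog h),
        integral_fieldBacklog φ n 0]
      refine add_le_add ?_ (hφ n)
      rcases Nat.eq_zero_or_pos n with rfl | hn
      · simpa using (backlogMean_nonneg q 0).trans (hB 0)
      · have hn' : (0 : ℝ) < n := by exact_mod_cast hn
        rw [inv_mul_le_iff₀ hn']
        refine (Finset.sum_le_card_nsmul _ _ B fun k _ => hB (k + 1)).trans_eq ?_
        rw [Finset.card_range, nsmul_eq_mul]
  obtain ⟨C, hC⟩ := exists_nat_gt (B / c)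
  have h1 := key C
  rw [div_lt_iff₀ hc] at hC
  linarith

lemma speed_lower (h : IsStrength M q) {m : ℝ} (hm : Tendsto (backlogMean q) atTop (𝓝 m))
    (hv0 : 0 < v)
    (hv : ∀ᵐ ω ∂fieldLaw q, Tendsto (fun t => (pos ω t : ℝ) / t) atTop (𝓝 v)) :
    (1 / v - 1) / 2 ≤ m := by
  refine le_of_ae_eventually_ge (μ := fieldLaw q) (K := 0)
    (integrable_average (integrable_backlog h)) (fun n ω => by rw [neg_zero]; positivity) ?_
    (fun n => (integral_average (integrable_backlog h) n).le)
    ((hm.comp (tendsto_add_atTop_nat 1)).cesaro)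
  filter_upwards [hv, ae_forall_good_field h] with ω hω hg c' hc'
  obtain ⟨T, hT, hTlim⟩ := exists_hitting_times hv0 hω
  obtain ⟨B, hB⟩ := negTime_bounded hv0 hω
  have hlim : Tendsto (fun n : ℕ => ((T n : ℝ) / n - B / n - 1) / 2) atTop
      (𝓝 ((1 / v - 0 - 1) / 2)) :=
    ((hTlim.sub (tendsto_const_div_atTop_nhds_zero_nat _)).sub_const 1).div_const 2
  rw [sub_zero] at hlim
  filter_upwards [hlim.eventually (lt_mem_nhds hc'), eventually_gt_atTop 0] with n hn hn0
  have hn0' : (0 : ℝ) < n := by exact_mod_cast hn0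
  refine hn.le.trans ?_
  rw [← totalBacklog_div]
  have h1 := (time_le hg (hT n).1).trans (Nat.add_le_add_right (Nat.add_le_add_right (hB _) _) _)
  have h2 : (T n : ℝ) ≤ B + n + 2 * totalBacklog ω n := by exact_mod_cast h1
  rw [le_div_iff₀ hn0', div_mul_eq_mul_div, div_le_iff₀ two_pos]
  have : ((T n : ℝ) / n - B / n - 1) * n = T n - B - n := by field_simp
  linarith

lemma speed_upper (h : IsStrength M q) {m : ℝ} (hm : Tendsto (backlogMean q) atTop (𝓝 m))
    (hv0 : 0 < v)
    (hv : ∀ᵐ ω ∂fieldLaw q, Tendsto (fun t => (pos ω t : ℝ) / t) atTop (𝓝 v)) :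
    m ≤ (1 / v - 1) / 2 := by
  have hi : ∀ K k : ℕ, Integrable (fun τ => ((min (backlog k τ) K : ℕ) : ℝ)) (stacksLaw q) :=
    fun K k => Integrable.of_bound ((measurable_of_countable fun z : ℕ => ((min z K : ℕ) : ℝ)).comp
      (measurable_backlog k)).aestronglyMeasurable K (ae_of_all _ fun τ => by
        rw [Real.norm_eq_abs, abs_of_nonneg (Nat.cast_nonneg _)]
        exact_mod_cast min_le_right _ _)
  have hmono : ∀ K : ℕ, Monotone fun k => ∫ τ, ((min (backlog k τ) K : ℕ) : ℝ) ∂stacksLaw q := by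
    intro K k l hkl
    refine integral_mono_ae (hi K k) (hi K l) ?_
    filter_upwards [ae_monotone_backlog h] with τ hτ
    exact_mod_cast min_le_min_right K (hτ hkl)
  have hbdd : ∀ K k : ℕ, ∫ τ, ((min (backlog k τ) K : ℕ) : ℝ) ∂stacksLaw q ≤ K := by
    intro K k
    refine (integral_mono (hi K k) (integrable_const (K : ℝ)) fun τ => ?_).trans_eq (by simp)
    exact Nat.cast_le.2 (min_le_right _ _)
  have htrunc : ∀ K k₀ : ℕ, ∫ τ, ((min (backlog k₀ τ) K : ℕ) : ℝ) ∂stacksLaw q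
      ≤ (1 / v - 1) / 2 := by
    intro K k₀
    have hlimK := tendsto_atTop_ciSup (hmono K) ⟨K, by rintro _ ⟨k, rfl⟩; exact hbdd K k⟩
    refine (ge_of_tendsto hlimK (eventually_ge_atTop k₀ |>.mono fun k hk => hmono K hk)).trans ?_
    rw [← neg_le_neg_iff]
    refine le_of_ae_eventually_ge (μ := fieldLaw q) (K := K)
      (f := fun n ω => -((n : ℝ)⁻¹ * ∑ x ∈ Finset.range n,
        ((min (fieldBacklog ω (n - x) x) K : ℕ) : ℝ)))
      (b := fun n => -((n : ℝ)⁻¹ * ∑ k ∈ Finset.range n,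
        ∫ τ, ((min (backlog (k + 1) τ) K : ℕ) : ℝ) ∂stacksLaw q))
      (fun n => (integrable_average (φ := fun z => ((min z K : ℕ) : ℝ)) (hi K) n).neg)
      (fun n ω => ?_) ?_ (fun n => ?_) ((hlimK.comp (tendsto_add_atTop_nat 1)).cesaro.neg)
    · rw [neg_le_neg_iff]
      rcases Nat.eq_zero_or_pos n with rfl | hn
      · simp
      · have hn' : (0 : ℝ) < n := by exact_mod_cast hn
        rw [inv_mul_le_iff₀ hn']
        refine (Finset.sum_le_card_nsmul _ _ (K : ℝ) fun x _ => ?_).trans_eq ?_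
        · exact_mod_cast min_le_right _ _
        · rw [Finset.card_range, nsmul_eq_mul]
    · filter_upwards [hv, ae_forall_good_field h] with ω hω hg c' hc'
      obtain ⟨T, hT, hTlim⟩ := exists_hitting_times hv0 hω
      have hlim : Tendsto (fun n : ℕ => -(((T n : ℝ) / n - 1) / 2 + K / n)) atTop
          (𝓝 (-((1 / v - 1) / 2 + 0))) :=
        (((hTlim.sub_const 1).div_const 2).add (tendsto_const_div_atTop_nhds_zero_nat _)).neg
      rw [add_zero] at hlim
      filter_upwards [hlim.eventually (lt_mem_nhds hc'), eventually_gt_atTop 0] with n hn hn0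
      have hn0' : (0 : ℝ) < n := by exact_mod_cast hn0
      refine hn.le.trans ?_
      rw [neg_le_neg_iff, inv_mul_le_iff₀ hn0']
      have h1 := le_hitting_time hg (hT n).1 (hT n).2
      have h2 : ∑ x ∈ Finset.range n, min (fieldBacklog ω (n - x) x) K + fieldBacklog ω n 0
          ≤ totalBacklog ω n + K := by
        obtain ⟨n, rfl⟩ := Nat.exists_eq_succ_of_ne_zero hn0.ne'
        rw [totalBacklog, Finset.sum_range_succ', Finset.sum_range_succ']
        have : ∑ x ∈ Finset.range n, min (fieldBacklog ω (n + 1 - (x + 1)) (x + 1 : ℕ)) K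
            ≤ ∑ x ∈ Finset.range n, fieldBacklog ω (n + 1 - (x + 1)) (x + 1 : ℕ) :=
          Finset.sum_le_sum fun x _ => min_le_left _ _
        simp only [Nat.cast_zero, Nat.sub_zero, Nat.succ_eq_add_one]
        have := min_le_right (fieldBacklog ω (n + 1) 0) K
        omega
      have h3 : (n : ℝ) + 2 * totalBacklog ω n ≤ T n + 2 * fieldBacklog ω n 0 := by exact_mod_cast h1
      have h4 : (∑ x ∈ Finset.range n, ((min (fieldBacklog ω (n - x) x) K : ℕ) : ℝ))
          + fieldBacklog ω n 0 ≤ totalBacklog ω n + K := by exact_mod_cast h2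
      have : (n : ℝ) * (((T n : ℝ) / n - 1) / 2 + K / n) = (T n - n) / 2 + K := by field_simp
      rw [this]
      linarith
    · rw [integral_neg, integral_average (φ := fun z => ((min z K : ℕ) : ℝ)) (hi K)]
  refine le_of_tendsto' hm fun k => ?_
  have hlim : Tendsto (fun K : ℕ => ∫ τ, ((min (backlog k τ) K : ℕ) : ℝ) ∂stacksLaw q) atTop
      (𝓝 (backlogMean q k)) := by
    refine tendsto_integral_of_dominated_convergence (fun τ => (backlog k τ : ℝ))
      (fun K => (hi K k).aestronglyMeasurable) (integrable_backlog h k)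
      (fun K => ae_of_all _ fun τ => ?_) (ae_of_all _ fun τ => ?_)
    · rw [Real.norm_eq_abs, abs_of_nonneg (Nat.cast_nonneg _)]
      exact_mod_cast min_le_left _ _
    · refine tendsto_const_nhds.congr' ?_
      filter_upwards [eventually_ge_atTop (backlog k τ)] with K hK
      rw [min_eq_left hK]
  exact le_of_tendsto' hlim fun K => htrunc K k

lemma speed_eq (h : IsStrength M q) (hα : fullMean M q 1 < -1)
    (hv : ∀ᵐ ω ∂fieldLaw q, Tendsto (fun t => (pos ω t : ℝ) / t) atTop (𝓝 v)) :
    v = 1 / (1 + 2 * (limitBinom2 M q / (-1 - fullMean M q 1))) := by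
  obtain ⟨B, hB⟩ := backlogMean_bounded h hα
  have hm := tendsto_backlogMean h hα
  have hv0 := speed_pos h hB hv
  have := le_antisymm (speed_lower h hm hv0 hv) (speed_upper h hm hv0 hv)
  rw [← this]
  field_simp
  ring

end Law

end CookieWalk

/-- **Theorem 1.2 (second part).** At a critical environment `p̄_c` (where `α(M,p̄_c) = 1`),
the ratio `v(M,p̄)/(α(M,p̄) − 1)` converges to a strictly positive constant as
`p̄ → p̄_c` within `{p̄ ∈ Ω^u_M : α(M,p̄) > 1}`. -/
theorem speed_right_derivative_at_critical
    (M : ℕ) (hM : 1 ≤ M) (V : (Fin M → ℝ) → ℝ)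
    (hV : ∀ p ∈ OmegaU M, ∀ (Ω : Type) [MeasurableSpace Ω] (P : Measure Ω)
      (X : ℕ → Ω → ℤ), IsCookieRW M p P X →
      ∀ᵐ ω ∂P, Tendsto (fun n => (X n ω : ℝ) / n) atTop (𝓝 (V p)))
    (pc : Fin M → ℝ) (hpc : pc ∈ OmegaU M) (hαc : cookieAlpha M pc = 1) :
    ∃ C > (0 : ℝ), Tendsto (fun p => V p / (cookieAlpha M p - 1))
      (𝓝[{p ∈ OmegaU M | 1 < cookieAlpha M p}] pc) (𝓝 C) := by
  have hqc := CookieWalk.isStrength_strengthSeq hpc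
  have hmc : CookieWalk.fullMean M (CookieWalk.strengthSeq M pc) 1 = -1 := by
    rw [CookieWalk.fullMean_strengthSeq, hαc]
  have hpos := CookieWalk.limitBinom2_pos hM hqc hmc
  refine ⟨1 / (2 * CookieWalk.limitBinom2 M (CookieWalk.strengthSeq M pc)), by positivity, ?_⟩
  have hspeed : ∀ p : {p ∈ OmegaU M | 1 < cookieAlpha M p},
      1 / ((cookieAlpha M p - 1) + 2 * CookieWalk.limitBinom2 M (CookieWalk.strengthSeq M p))
        = V p / (cookieAlpha M p - 1) := by
    rintro ⟨p, hp, hα⟩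
    rw [CookieWalk.speed_eq (CookieWalk.isStrength_strengthSeq hp)
      (by rw [CookieWalk.fullMean_strengthSeq]; linarith)
      (hV p hp _ _ _ (CookieWalk.isCookieRW_pos hp)), CookieWalk.fullMean_strengthSeq]
    have hne : cookieAlpha M p - 1 ≠ 0 := by linarith
    rw [show -1 - -cookieAlpha M p = cookieAlpha M p - 1 by ring, div_div]
    congr 1
    field_simp
  rw [nhdsWithin, ← map_comap_setCoe_val, tendsto_map'_iff]
  have hcoe : Tendsto (fun p : {p ∈ OmegaU M | 1 < cookieAlpha M p} => (p : Fin M → ℝ))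
      (comap (↑) (𝓝 pc)) (𝓝 pc) := tendsto_comap
  have hcont : Continuous (cookieAlpha M) := by unfold cookieAlpha; fun_prop
  have hlim := CookieWalk.tendsto_limitBinom2
    (fun p : {p ∈ OmegaU M | 1 < cookieAlpha M p} => CookieWalk.isStrength_strengthSeq p.2.1) hqc
    (((CookieWalk.continuous_strengthSeq M).tendsto pc).comp hcoe)
    (fun p => by
      have := p.2.2
      simp only [CookieWalk.fullMean_strengthSeq]; linarith) hmc.le
  have hα := ((hcont.tendsto pc).comp hcoe).sub_const 1
  rw [hαc, sub_self] at hα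
  have hden := hα.add (hlim.const_mul 2)
  rw [zero_add] at hden
  exact (tendsto_const_nhds.div hden (by positivity)).congr hspeed

end
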